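/- arXiv:2204.13129 — 3 statements merged into one kernel-verified Lean document; each statement's English description precedes it below -/
import Mathlib

section
/- For every real N > 0 and every real c > 0, the limit inferior as n → ∞ (over integers n > c) of the difference H({P_l(N,n,c/n)}_{l∈ℕ}) − H({P_l(N,n,1−c/n)}_{l∈ℕ}) of Shannon entropies is at least H({q_k(N,c)}_{k∈ℤ}) − H({p_k(N,c)}_{k∈ℕ}). (This is the classical form of the paper's Theorem 8: the left-hand differences equal the coherent informations I_coh(Φ_{c/n,|n⟩⟨n|}, τ_N), and the theorem asserts liminf_{n→∞} I_coh(Φ_{c/n,|n⟩⟨n|}, τ_N) ≥ H(q(N,c)) − H(p(N,c)).) -/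
/-- The eigenvalues `P_l(N,n,λ)` of the Fock-diagonal state `Φ_{λ,|n⟩⟨n|}(τ_N)`. -/
noncomputable def Pl (N : ℝ) (n l : ℕ) (lam : ℝ) : ℝ :=
  ((1 + N * lam) ^ (l + n + 1))⁻¹ *
    ∑ m ∈ Finset.Icc (n - l) n,
      lam ^ (2 * m + l - n) * (1 - lam) ^ (n - m) * N ^ (l + m - n) * (N + 1) ^ m *
        (n.choose m : ℝ) * (l.choose (n - m) : ℝ)

/-- The limiting distribution `q_k(N,c)` on `ℤ`. -/
noncomputable def qdist (N c : ℝ) (k : ℤ) : ℝ :=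
  Real.exp (-c * (2 * N + 1)) *
    (if 0 ≤ k then (c * N) ^ k.natAbs else (c * (N + 1)) ^ k.natAbs) *
    ∑' m : ℕ, (c ^ 2 * N * (N + 1)) ^ m / ((m.factorial : ℝ) * ((m + k.natAbs).factorial : ℝ))

/-- The limiting distribution `p_k(N,c)` on `ℕ`. -/
noncomputable def pdist (N c : ℝ) (k : ℕ) : ℝ :=
  N ^ k / (N + 1) ^ (k + 1) * Real.exp (-c / (N + 1)) *
    ∑ m ∈ Finset.range (k + 1), (k.choose m : ℝ) * (c / (N * (N + 1))) ^ m / (m.factorial : ℝ)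

/-- Shannon entropy (base 2) of a family of nonnegative reals, with `0 log 0 = 0`. -/
noncomputable def shannonEntropy {ι : Type*} (r : ι → ℝ) : ℝ :=
  -∑' i, r i * Real.logb 2 (r i)

open Filter Topology

lemma Pl_eq (N : ℝ) (n l : ℕ) (lam : ℝ) : Pl N n l lam = ((1 + N * lam) ^ (l + n + 1))⁻¹ *
    ∑ j ∈ Finset.range (n + 1), (lam * (N + 1)) ^ (n - j) * (lam * N) ^ (l - j) * (1 - lam) ^ j *
      (n.choose j : ℝ) * (l.choose j : ℝ) := by
  unfold Pl
  congr 1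
  rw [← Finset.sum_range_reflect]
  have hsub : Finset.Icc (n - l) n ⊆ Finset.range (n + 1) := by
    intro m hm
    simp only [Finset.mem_Icc, Finset.mem_range] at *
    omega
  rw [← Finset.sum_subset hsub]
  · apply Finset.sum_congr rfl
    intro m hm
    simp only [Finset.mem_Icc] at hm
    have e1 : n + 1 - 1 - m = n - m := by omega
    have e2 : n - (n - m) = m := by omega
    have e3 : l - (n - m) = l + m - n := by omega
    have e4 : 2 * m + l - n = m + (l + m - n) := by omega
    rw [e1, e2, e3, e4, Nat.choose_symm hm.2, pow_add, mul_pow, mul_pow]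
    ring
  · intro m hm hm'
    simp only [Finset.mem_Icc, Finset.mem_range] at hm hm'
    have : l < n + 1 - 1 - m := by omega
    rw [Nat.choose_eq_zero_of_lt this]
    simp

lemma Pl_nonneg {N : ℝ} (hN : 0 < N) (n l : ℕ) {lam : ℝ} (h0 : 0 ≤ lam) (h1 : lam ≤ 1) :
    0 ≤ Pl N n l lam := by
  unfold Pl
  have : 0 ≤ 1 - lam := by linarith
  positivity

lemma choose_bd (l j : ℕ) (y : ℝ) (hy : 0 ≤ y) (hy1 : y < 1) :
    (l.choose j : ℝ) * y ^ (l - j) * (1 - y) ^ j ≤ 1 := by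
  rcases le_or_gt j l with h | h
  · have h2 := add_pow (1 - y) y l
    have h3 : (1 - y) ^ j * y ^ (l - j) * (l.choose j : ℝ) ≤
        ∑ m ∈ Finset.range (l + 1), (1 - y) ^ m * y ^ (l - m) * (l.choose m : ℝ) := by
      apply Finset.single_le_sum (f := fun m => (1 - y) ^ m * y ^ (l - m) * (l.choose m : ℝ))
      · intro i _
        have : 0 ≤ 1 - y := by linarith
        positivity
      · simp; omega
    rw [← h2] at h3
    simp at h3
    linarith
  · rw [Nat.choose_eq_zero_of_lt h]; simp

lemma Pl_bound {N : ℝ} (hN : 0 < N) (n l : ℕ) {lam z : ℝ} (h0 : 0 ≤ lam) (h1 : lam ≤ 1)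
    (hz : 0 < z) (hD : 0 < 1 + N * lam * (1 - z)) :
    Pl N n l lam * z ^ l ≤
      ((lam * (N + 1) + (1 - lam) * (z / (1 + N * lam * (1 - z)))) / (1 + N * lam)) ^ n := by
  set D := 1 + N * lam * (1 - z) with hDd
  set S := 1 + N * lam with hS
  have hS1 : 1 ≤ S := by have : 0 ≤ N * lam := by positivity
                         linarith
  have hS0 : 0 < S := by linarith
  have hl : 0 ≤ 1 - lam := by linarith
  have key : ∀ j, (S ^ (l + n + 1))⁻¹ * ((lam * (N + 1)) ^ (n - j) * (lam * N) ^ (l - j)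
      * (1 - lam) ^ j * (n.choose j : ℝ) * (l.choose j : ℝ)) * z ^ l ≤
      (S ^ (n + 1))⁻¹ * (((1 - lam) * (z / D)) ^ j * (lam * (N + 1)) ^ (n - j) *
        (n.choose j : ℝ)) := by
    intro j
    rcases le_or_gt j l with h | h
    · have hy : 0 ≤ z * N * lam / S := by positivity
      have e : 1 - z * N * lam / S = D / S := by field_simp; rw [hDd, hS]; ring
      have hy1 : z * N * lam / S < 1 := by
        have : 0 < D / S := by positivity
        linarith
      have hb := choose_bd l j _ hy hy1
      rw [e] at hb
      have hDS : (0:ℝ) < (D / S) ^ j := by positivity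
      rw [← le_div_iff₀ hDS] at hb
      have hnn : 0 ≤ (S ^ (n + 1))⁻¹ * ((lam * (N + 1)) ^ (n - j) * (1 - lam) ^ j *
        (n.choose j : ℝ)) * (z / S) ^ j := by positivity
      have := mul_le_mul_of_nonneg_left hb hnn
      refine le_trans (le_of_eq ?_) (this.trans (le_of_eq ?_))
      · obtain ⟨i, rfl⟩ := Nat.exists_eq_add_of_le h
        simp only [Nat.add_sub_cancel_left]
        simp only [div_pow, mul_pow, pow_add]
        field_simp
      · simp only [div_pow, mul_pow, pow_add]
        field_simp
    · rw [Nat.choose_eq_zero_of_lt h]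
      simp
      positivity
  rw [Pl_eq, Finset.mul_sum, Finset.sum_mul]
  refine (Finset.sum_le_sum (fun j _ => key j)).trans ?_
  rw [← Finset.mul_sum, ← add_pow, add_comm ((1 - lam) * _), div_pow, div_eq_inv_mul (_ ^ n)]
  apply mul_le_mul_of_nonneg_right
  · apply inv_anti₀ (by positivity)
    exact pow_le_pow_right₀ hS1 (by omega)
  · positivity

lemma abs_mul_logb_le {x B : ℝ} (hx : 0 ≤ x) (hxB : x ≤ B) :
    ‖x * Real.logb 2 x‖ ≤ (2 * √B + B ^ 2) / Real.log 2 := by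
  have h2 : 0 < Real.log 2 := Real.log_pos (by norm_num)
  rw [Real.logb, ← mul_div_assoc, norm_div, Real.norm_eq_abs, Real.norm_eq_abs, abs_of_pos h2]
  apply div_le_div_of_nonneg_right _ h2.le
  have hs : √x ≤ √B := Real.sqrt_le_sqrt hxB
  have hsB : x ^ 2 ≤ B ^ 2 := by gcongr
  refine le_trans ?_ (add_le_add (mul_le_mul_of_nonneg_left hs (by norm_num : (0:ℝ) ≤ 2)) hsB)
  rcases hx.eq_or_lt with rfl | hx
  · simp
  rcases le_or_gt x 1 with h | h
  · have := Real.abs_log_mul_self_lt (√x) (Real.sqrt_pos.2 hx) (by simpa using h)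
    rw [Real.log_sqrt hx.le] at this
    have h3 : x * Real.log x = 2 * √x * (Real.log x / 2 * √x) := by
      rw [show 2 * √x * (Real.log x / 2 * √x) = (√x * √x) * Real.log x by ring,
        Real.mul_self_sqrt hx.le]
    rw [h3, abs_mul, abs_of_nonneg (by positivity : 0 ≤ 2 * √x)]
    nlinarith [Real.sqrt_nonneg x, sq_nonneg x]
  · have h3 := Real.log_le_sub_one_of_pos hx
    have h4 := Real.log_pos h
    rw [abs_of_pos (by positivity)]
    nlinarith [Real.sqrt_nonneg x]

/-- dominated convergence for entropies -/
lemma entropy_tendsto {ι : Type*} {f : ℕ → ι → ℝ} {g B : ι → ℝ}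
    (hB : Summable (fun i => √(B i))) (hB2 : Summable (fun i => B i ^ 2))
    (hlim : ∀ i, Tendsto (fun n => f n i) atTop (𝓝 (g i)))
    (hb : ∀ᶠ n in atTop, ∀ i, 0 ≤ f n i ∧ f n i ≤ B i) :
    Tendsto (fun n => shannonEntropy (f n)) atTop (𝓝 (shannonEntropy g)) := by
  unfold shannonEntropy
  apply Tendsto.neg
  apply tendsto_tsum_of_dominated_convergence
    (bound := fun i => (2 * √(B i) + B i ^ 2) / Real.log 2)
  · exact ((hB.mul_left 2).add hB2).div_const _
  · intro i
    have hcont : Continuous (fun x : ℝ => x * Real.logb 2 x) := by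
      have := Real.continuous_mul_log.div_const (Real.log 2)
      simpa [Real.logb, mul_div_assoc] using this
    exact (hcont.tendsto _).comp (hlim i)
  · filter_upwards [hb] with n hn i
    exact abs_mul_logb_le (hn i).1 (hn i).2

lemma tendsto_div_nat (c : ℝ) : Tendsto (fun n : ℕ => c / (n : ℝ)) atTop (𝓝 0) :=
  tendsto_const_div_atTop_nhds_zero_nat c

lemma one_add_div_pow_le (d : ℝ) (hd : 0 ≤ d) (n : ℕ) : (1 + d / n) ^ n ≤ Real.exp d := by
  rcases Nat.eq_zero_or_pos n with rfl | hn
  · simpa using hd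
  have hn' : (0:ℝ) < n := by exact_mod_cast hn
  calc (1 + d / n) ^ n ≤ (Real.exp (d / n)) ^ n := by
        gcongr
        linarith [Real.add_one_le_exp (d / n)]
    _ = Real.exp d := by
        rw [← Real.exp_nat_mul]; congr 1; field_simp

/-- second part -/
lemma p_lim (N c : ℝ) (hN : 0 < N) (hc : 0 < c) (l : ℕ) :
    Tendsto (fun n : ℕ => Pl N n l (1 - c / n)) atTop (𝓝 (pdist N c l)) := by
  set d := N * c / (N + 1) with hd
  have hmain : Tendsto (fun n : ℕ => ∑ j ∈ Finset.range (l + 1),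
      ((1 + (-d) / n) ^ n)⁻¹ * ((1 + N * (1 - c / n)) ^ (l + 1))⁻¹ * ((N + 1) ^ j)⁻¹ *
      ((n.choose j : ℝ) * (c / n) ^ j * (1 - c / n) ^ (n - j)) *
       ((1 - c / n) * N) ^ (l - j) * (l.choose j : ℝ)) atTop
      (𝓝 (∑ j ∈ Finset.range (l + 1),
       (Real.exp (-d))⁻¹ * ((1 + N * (1 - 0)) ^ (l + 1))⁻¹ * ((N + 1) ^ j)⁻¹ *
        (Real.exp (-c) * (c ^ j) / j.factorial) * ((1 - 0) * N) ^ (l - j) * (l.choose j : ℝ))) := by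
    have h0 := tendsto_div_nat c
    have h1 : Tendsto (fun n : ℕ => 1 - c / (n : ℝ)) atTop (𝓝 (1 - 0)) := h0.const_sub 1
    apply tendsto_finsetSum
    intro j _
    have h2 := ProbabilityTheory.tendsto_choose_mul_pow_of_tendsto_mul_atTop
      (p := fun n : ℕ => c / (n : ℝ)) (r := c) j (by
        apply tendsto_const_nhds.congr'
        filter_upwards [eventually_gt_atTop 0] with n hn
        have : (n:ℝ) ≠ 0 := by exact_mod_cast hn.ne'
        field_simp)
    have h3 := (Real.tendsto_one_add_div_pow_exp (-d)).inv₀ (Real.exp_pos _).ne'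
    have h4 := (((h1.const_mul N).const_add 1).pow (l + 1)).inv₀ (by simp; positivity)
    exact ((((h3.mul h4).mul_const _).mul h2).mul ((h1.mul_const N).pow (l - j))).mul_const _
  have hval : (∑ j ∈ Finset.range (l + 1),
       (Real.exp (-d))⁻¹ * ((1 + N * (1 - 0)) ^ (l + 1))⁻¹ * ((N + 1) ^ j)⁻¹ *
        (Real.exp (-c) * (c ^ j) / j.factorial) * ((1 - 0) * N) ^ (l - j) * (l.choose j : ℝ)) =
        pdist N c l := by
    unfold pdist
    rw [Finset.mul_sum]
    apply Finset.sum_congr rfl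
    intro j hj
    have hj : j ≤ l := by simp at hj; omega
    obtain ⟨i, rfl⟩ := Nat.exists_eq_add_of_le hj
    have he : Real.exp (-c / (N + 1)) = (Real.exp (-d))⁻¹ * Real.exp (-c) := by
      rw [← Real.exp_neg, ← Real.exp_add]
      congr 1
      rw [hd]
      field_simp
      ring
    rw [he, add_comm 1 (N * (1 - 0)), Nat.add_sub_cancel_left]
    simp only [sub_zero, mul_one, one_mul, div_pow, mul_pow, pow_add, pow_one]
    field_simp
  rw [← hval]
  refine hmain.congr' ?_
  have h0 := tendsto_div_nat c
  filter_upwards [eventually_ge_atTop l, eventually_gt_atTop 0,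
    h0.eventually (gt_mem_nhds one_pos)] with n hn hn0 hcn
  rw [Pl_eq, ← Finset.sum_subset (s₁ := Finset.range (l + 1)) (s₂ := Finset.range (n + 1)), Finset.mul_sum]
  · apply Finset.sum_congr rfl
    intro j hj
    have hj : j ≤ l := by simp at hj; omega
    have hjn : j ≤ n := hj.trans hn
    have e : 1 + N * (1 - c / n) = (N + 1) * (1 + (-d) / n) := by
      have : (n:ℝ) ≠ 0 := by exact_mod_cast hn0.ne'
      rw [hd]; field_simp; ring
    have hpos : 0 < 1 + N * (1 - c / n) := by
      have : 0 < 1 - c / (n:ℝ) := by linarith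
      positivity
    have hpos2 : 0 < 1 + (-d) / n := by
      rw [e] at hpos
      exact (pos_iff_pos_of_mul_pos hpos).1 (by linarith)
    rw [show l + n + 1 = n + (l + 1) by ring, pow_add _ n, e, sub_sub_cancel]
    generalize 1 + (-d) / (n:ℝ) = u at *
    generalize 1 - c / (n:ℝ) = v at *
    rw [mul_pow v (N+1) (n - j), mul_pow (N + 1) u n, pow_sub₀ (N + 1) (by positivity) hjn]
    have : N + 1 ≠ 0 := by positivity
    field_simp
  · intro j; simp; omega
  · intro j hj hj'
    simp at hj hj'
    rw [Nat.choose_eq_zero_of_lt (show l < j by omega)]; simp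

lemma summable_aux {r K : ℝ} (hr : 0 ≤ r) (hr1 : r < 1) (hK : 0 ≤ K) :
    Summable (fun k : ℕ => √(K * r ^ k)) ∧ Summable (fun k : ℕ => (K * r ^ k) ^ 2) := by
  constructor
  · have : (fun k : ℕ => √(K * r ^ k)) = fun k => √K * (√r) ^ k := by
      ext k
      have e : r ^ k = (√r ^ k) ^ 2 := by rw [← pow_mul, mul_comm, pow_mul, Real.sq_sqrt hr]
      rw [Real.sqrt_mul hK, e, Real.sqrt_sq (by positivity)]
    rw [this]
    apply Summable.mul_left
    apply summable_geometric_of_lt_one (Real.sqrt_nonneg _)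
    rw [Real.sqrt_lt' one_pos]; simpa using hr1
  · have : (fun k : ℕ => (K * r ^ k) ^ 2) = fun k => K ^ 2 * (r ^ 2) ^ k := by
      ext k
      rw [mul_pow]; ring
    rw [this]
    apply Summable.mul_left
    apply summable_geometric_of_lt_one (by positivity)
    nlinarith

lemma p_entropy (N c : ℝ) (hN : 0 < N) (hc : 0 < c) :
    Tendsto (fun n : ℕ => shannonEntropy (fun l : ℕ => Pl N n l (1 - c / n))) atTop
      (𝓝 (shannonEntropy (pdist N c))) := by
  set z := 1 + 1 / (2 * N) with hz
  have hzN : N * (z - 1) = 1 / 2 := by rw [hz]; field_simp; ring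
  have hz1 : 1 < z := by rw [hz]; have : 0 < 1 / (2 * N) := by positivity
                         linarith
  obtain ⟨s1, s2⟩ := summable_aux (r := 1 / z) (K := Real.exp (2 * z * c)) (by positivity)
    (by rw [div_lt_one (by linarith)]; exact hz1) (by positivity)
  refine entropy_tendsto s1 s2 (p_lim N c hN hc) ?_
  filter_upwards [eventually_gt_atTop 0, (tendsto_div_nat c).eventually (gt_mem_nhds one_pos)]
    with n hn0 hcn l
  have hn : (0:ℝ) < n := by exact_mod_cast hn0
  have hcn0 : 0 < c / n := by positivity
  have h0 : 0 ≤ 1 - c / (n:ℝ) := by linarith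
  have h1 : 1 - c / (n:ℝ) ≤ 1 := by linarith
  refine ⟨Pl_nonneg hN n l h0 h1, ?_⟩
  have hDe : 1 + N * (1 - c / n) * (1 - z) = 1 - (1 - c / n) * (1 / 2) := by rw [← hzN]; ring
  have hD : 1 / 2 ≤ 1 + N * (1 - c / n) * (1 - z) := by rw [hDe]; linarith
  have hb := Pl_bound hN n l h0 h1 (z := z) (by linarith) (by linarith)
  rw [one_div, inv_pow, ← div_eq_mul_inv, le_div_iff₀ (by positivity)]
  refine hb.trans (le_trans ?_ (one_add_div_pow_le _ (by positivity) n))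
  have hS : 1 ≤ 1 + N * (1 - c / n) := by
    have : 0 ≤ N * (1 - c / n) := by positivity
    linarith
  apply pow_le_pow_left₀
  · have : 0 ≤ 1 - (1 - c / (n:ℝ)) := by linarith
    have : 0 < 1 + N * (1 - c / n) * (1 - z) := by linarith
    positivity
  rw [div_le_iff₀ (by linarith), sub_sub_cancel]
  have hzD : z / (1 + N * (1 - c / n) * (1 - z)) ≤ 2 * z := by
    rw [div_le_iff₀ (by linarith)]; nlinarith
  have h5 := mul_le_mul_of_nonneg_left hzD hcn0.le
  have h6 : 0 ≤ 2 * z * c / n := by positivity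
  have h7 : 2 * z * c / n = c / n * (2 * z) := by ring
  have h8 := mul_le_mul_of_nonneg_left hS h6
  nlinarith

lemma Pl_eq_tsum (N lam : ℝ) (n a b : ℕ) (hab : a = 0 ∨ b = 0) (hb : b ≤ n) :
    Pl N n (n + a - b) lam = ∑' m : ℕ, ((1 + N * lam) ^ (n + a - b + n + 1))⁻¹ *
      ((n.choose (m + b) : ℝ) * lam ^ (m + b) * (1 - lam) ^ (n - (m + b))) *
      (((n + a - b).choose (m + a) : ℝ) * lam ^ (m + a)) * ((N + 1) ^ (m + b) * N ^ (m + a)) := by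
  obtain ⟨n', rfl⟩ := Nat.exists_eq_add_of_le hb
  rw [show b + n' + a - b = n' + a by omega, Pl_eq, ← Finset.sum_range_reflect,
    show b + n' + 1 = b + (n' + 1) by ring, Finset.sum_range_add, tsum_eq_sum (s := Finset.range (n' + 1))]
  · rw [Finset.sum_eq_zero, zero_add, Finset.mul_sum]
    · apply Finset.sum_congr rfl
      intro i hi
      have hi : i ≤ n' := by simp at hi; omega
      obtain ⟨t, rfl⟩ := Nat.exists_eq_add_of_le hi
      have e1 : b + (i + t + 1) - 1 - (b + i) = t := by omega
      have e2 : b + (i + t) - t = i + b := by omega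
      have e3 : i + t + a - t = i + a := by omega
      have e4 : b + (i + t) - (i + b) = t := by omega
      have c1 : (b + (i + t)).choose t = (b + (i + t)).choose (i + b) :=
        Nat.choose_symm_of_eq_add (by omega)
      have c2 : (i + t + a).choose t = (i + t + a).choose (i + a) :=
        Nat.choose_symm_of_eq_add (by omega)
      rw [e1, e2, e3, e4, c1, c2, mul_pow, mul_pow]
      rw [show i + t + a + (b + (i + t)) + 1 = i + t + a + b + (i + t + 1) by ring]
      ring
    · intro m hm
      simp at hm
      rw [Nat.choose_eq_zero_of_lt (show n' + a < b + (n' + 1) - 1 - m by omega)]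
      simp
  · intro i hi
    simp at hi
    rw [Nat.choose_eq_zero_of_lt (show b + n' < i + b by omega)]
    simp

lemma nat_mul_tendsto (c : ℝ) : Tendsto (fun n : ℕ => (n : ℝ) * (c / n)) atTop (𝓝 c) := by
  apply tendsto_const_nhds.congr'
  filter_upwards [eventually_gt_atTop 0] with n hn
  have : (n:ℝ) ≠ 0 := by exact_mod_cast hn.ne'
  field_simp

lemma choose_shift_tendsto (c : ℝ) (a b r : ℕ) :
    Tendsto (fun n : ℕ => ((n + a - b).choose r : ℝ) * (c / n) ^ r) atTop
      (𝓝 (c ^ r / r.factorial)) := by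
  have h := ProbabilityTheory.tendsto_choose_mul_pow_atTop
    (p := fun l : ℕ => c / ((l : ℝ) + b - a)) (r := c) r (by
      have h1 : Tendsto (fun l : ℕ => ((b:ℝ) - a) / (l:ℝ)) atTop (𝓝 0) := tendsto_div_nat _
      have h2 := (tendsto_const_nhds (x := c)).div (h1.const_add 1) (by norm_num)
      simp only [add_zero, div_one] at h2
      refine h2.congr' ?_
      filter_upwards [eventually_gt_atTop 0, eventually_gt_atTop (a + b)] with l hl hl2
      have h3 : (l:ℝ) ≠ 0 := by exact_mod_cast hl.ne'
      have h4 : (a:ℝ) + b < l := by exact_mod_cast hl2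
      have h5 : (0:ℝ) ≤ b := by positivity
      have h6 : (l:ℝ) + b - a ≠ 0 := by
        have : 0 < (l:ℝ) + b - a := by linarith
        exact this.ne'
      have h7 : 1 + ((b:ℝ) - a) / l = (l + b - a) / l := by field_simp; ring
      simp only [Pi.div_apply, h7]
      field_simp)
  have ht : Tendsto (fun n : ℕ => n + a - b) atTop atTop := by
    apply tendsto_atTop_mono (f := fun n => n - b) (fun n => by omega)
    exact tendsto_sub_atTop_nat b
  refine (h.comp ht).congr' ?_
  filter_upwards [eventually_ge_atTop b] with n hn
  simp only [Function.comp]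
  rw [Nat.cast_sub (by omega)]
  push_cast
  congr 3
  ring

lemma S_tendsto (N c : ℝ) (hN : 0 < N) (hc : 0 < c) (a b : ℕ) :
    Tendsto (fun n : ℕ => ((1 + N * (c / n)) ^ (n + a - b + n + 1))⁻¹) atTop
      (𝓝 (Real.exp (-(2 * N * c)))) := by
  have h1 := Real.tendsto_one_add_div_pow_exp (N * c)
  have h0 : Tendsto (fun n : ℕ => 1 + N * c / (n:ℝ)) atTop (𝓝 (1 + 0)) :=
    (tendsto_div_nat (N * c)).const_add 1
  have h2 := (((h1.mul h1).mul (h0.pow (a + 1))).div (h0.pow b) (by norm_num)).inv₀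
    (by simp)
  have e : ((Real.exp (N * c) * Real.exp (N * c) * (1 + 0) ^ (a + 1)) / (1 + 0) ^ b)⁻¹ =
      Real.exp (-(2 * N * c)) := by
    rw [← Real.exp_add, Real.exp_neg]; simp; ring_nf
  rw [e] at h2
  refine h2.congr' ?_
  filter_upwards [eventually_ge_atTop b] with n hn
  simp only [Pi.div_apply, Pi.inv_apply]
  congr 1
  have hpos : 0 < 1 + N * c / n := by positivity
  rw [div_eq_iff (by positivity), mul_div_assoc, ← pow_add, ← pow_add, ← pow_add]
  congr 1
  omega

lemma q_lim_nat (N c : ℝ) (hN : 0 < N) (hc : 0 < c) (a b : ℕ) (hab : a = 0 ∨ b = 0) :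
    Tendsto (fun n : ℕ => Pl N n (n + a - b) (c / n)) atTop
      (𝓝 (∑' m : ℕ, Real.exp (-(2 * N * c)) *
        (Real.exp (-c) * c ^ (m + b) / (m + b).factorial) *
        (c ^ (m + a) / (m + a).factorial) * ((N + 1) ^ (m + b) * N ^ (m + a)))) := by
  have hT := tendsto_tsum_of_dominated_convergence (𝓕 := (atTop : Filter ℕ))
    (f := fun (n : ℕ) (m : ℕ) => ((1 + N * (c / n)) ^ (n + a - b + n + 1))⁻¹ *
      ((n.choose (m + b) : ℝ) * (c / n) ^ (m + b) * (1 - (c / n)) ^ (n - (m + b))) *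
      (((n + a - b).choose (m + a) : ℝ) * (c / n) ^ (m + a)) * ((N + 1) ^ (m + b) * N ^ (m + a)))
    (g := fun m : ℕ => Real.exp (-(2 * N * c)) *
        (Real.exp (-c) * c ^ (m + b) / (m + b).factorial) *
        (c ^ (m + a) / (m + a).factorial) * ((N + 1) ^ (m + b) * N ^ (m + a)))
    (bound := fun m : ℕ => ((c * (N + 1)) ^ b * (c * (1 + a) * N) ^ a) *
      ((c * (N + 1) * (c * (1 + a) * N)) ^ m / m.factorial))
    ((Real.summable_pow_div_factorial _).mul_left _)
    (fun m => (((S_tendsto N c hN hc a b).mul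
      (ProbabilityTheory.tendsto_choose_mul_pow_of_tendsto_mul_atTop (m + b)
        (nat_mul_tendsto c))).mul (choose_shift_tendsto c a b (m + a))).mul_const _)
    (by
      filter_upwards [eventually_gt_atTop 0, (tendsto_div_nat c).eventually (gt_mem_nhds one_pos)]
        with n hn0 hcn m
      have hn : (0:ℝ) < n := by exact_mod_cast hn0
      have hcn0 : 0 < c / n := by positivity
      have h1 : 0 ≤ 1 - c / (n:ℝ) := by linarith
      rw [Real.norm_of_nonneg (by positivity)]
      have b1 : ((1 + N * (c / n)) ^ (n + a - b + n + 1))⁻¹ ≤ 1 := by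
        apply inv_le_one_of_one_le₀
        apply one_le_pow₀
        have : 0 ≤ N * (c / n) := by positivity
        linarith
      have b2 : (n.choose (m + b) : ℝ) * (c / n) ^ (m + b) * (1 - (c / n)) ^ (n - (m + b)) ≤
          c ^ (m + b) / m.factorial := by
        calc _ ≤ (n : ℝ) ^ (m + b) / (m + b).factorial * (c / n) ^ (m + b) * 1 := by
              gcongr
              · exact Nat.choose_le_pow_div _ _
              · exact pow_le_one₀ h1 (by linarith)
          _ = c ^ (m + b) / (m + b).factorial := by
              rw [div_pow]; field_simp
          _ ≤ _ := by
              gcongr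
              omega
      have b3 : ((n + a - b).choose (m + a) : ℝ) * (c / n) ^ (m + a) ≤ (c * (1 + a)) ^ (m + a) := by
        have hl : ((n + a - b : ℕ) : ℝ) ≤ n * (1 + a) := by
          have h3 : n + a - b ≤ n * (1 + a) := by
            have : 1 * a ≤ n * a := Nat.mul_le_mul_right a hn0
            rw [mul_add]; omega
          exact_mod_cast h3
        calc _ ≤ ((n + a - b : ℕ) : ℝ) ^ (m + a) * (c / n) ^ (m + a) := by
              gcongr
              refine (Nat.choose_le_pow_div _ _).trans ?_
              apply div_le_self (by positivity)
              exact_mod_cast Nat.one_le_iff_ne_zero.2 (Nat.factorial_ne_zero _)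
          _ ≤ (n * (1 + a)) ^ (m + a) * (c / n) ^ (m + a) := by gcongr
          _ = _ := by
              rw [← mul_pow]; congr 1; field_simp
      calc _ ≤ 1 * (c ^ (m + b) / m.factorial) * ((c * (1 + a)) ^ (m + a)) *
            ((N + 1) ^ (m + b) * N ^ (m + a)) := by gcongr
        _ = _ := by
          simp only [mul_pow, pow_add]
          ring)
  refine hT.congr' ?_
  filter_upwards [eventually_ge_atTop b] with n hn
  rw [Pl_eq_tsum N (c / n) n a b hab hn]

lemma q_val (N c : ℝ) (a b : ℕ) (k : ℤ) (hk : k = (a : ℤ) - b) (hab : a = 0 ∨ b = 0) :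
    (∑' m : ℕ, Real.exp (-(2 * N * c)) *
        (Real.exp (-c) * c ^ (m + b) / (m + b).factorial) *
        (c ^ (m + a) / (m + a).factorial) * ((N + 1) ^ (m + b) * N ^ (m + a))) = qdist N c k := by
  unfold qdist
  rw [← tsum_mul_left]
  apply tsum_congr
  intro m
  rw [show -c * (2 * N + 1) = -(2 * N * c) + -c by ring, Real.exp_add]
  rcases hab with rfl | rfl
  · have h1 : k.natAbs = b := by omega
    rw [h1]
    by_cases h : 0 ≤ k
    · have : b = 0 := by omega
      subst this
      rw [if_pos h]
      simp only [add_zero, pow_zero, mul_pow, pow_add]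
      field_simp
      ring
    · rw [if_neg h]
      simp only [add_zero, mul_pow, pow_add]
      field_simp
      ring
  · have h1 : k.natAbs = a := by omega
    have h : 0 ≤ k := by omega
    rw [h1, if_pos h]
    simp only [add_zero, mul_pow, pow_add]
    field_simp
    ring

lemma q_dom (N c : ℝ) (hN : 0 < N) (hc : 0 < c) (n a b l : ℕ) (hab : a = 0 ∨ b = 0)
    (hl : l + b = n + a) (hn0 : 0 < n) (hcn : c / n ≤ 1) (hcN : N * (c / n) ≤ 1 / 2) :
    Pl N n l (c / n) ≤ Real.exp ((3 * N + 2) * c) * (1 / 2) ^ (a + b) := by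
  have hn : (0:ℝ) < n := by exact_mod_cast hn0
  have hK := one_add_div_pow_le ((3 * N + 2) * c) (by positivity) n
  have hdiv : (3 * N + 2) * c / n = (3 * N + 2) * (c / n) := by ring
  rw [hdiv] at hK
  have hcn0 : 0 < c / n := by positivity
  generalize c / (n:ℝ) = u at *
  have hS : 1 ≤ 1 + N * u := by
    have : 0 ≤ N * u := by positivity
    linarith
  have hu : 0 ≤ 1 - u := by linarith
  have hNu : 0 < N * u := by positivity
  rw [one_div, inv_pow, ← div_eq_mul_inv, le_div_iff₀ (by positivity)]
  refine le_trans ?_ hK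
  rcases hab with rfl | rfl
  · have hb := Pl_bound hN n l hcn0.le hcn (z := 1 / 2) (by norm_num) (by nlinarith)
    have hn' : n = l + b := by omega
    have hX : (u * (N + 1) + (1 - u) * (1 / 2 / (1 + N * u * (1 - 1 / 2)))) / (1 + N * u) ≤
        (1 / 2) * (1 + (3 * N + 2) * u) := by
      have h3 : 1 / 2 / (1 + N * u * (1 - 1 / 2)) ≤ 1 / 2 := by
        apply div_le_self (by norm_num); nlinarith
      have h4 := mul_le_mul_of_nonneg_left h3 hu
      refine (div_le_self ?_ hS).trans ?_
      · have : 0 < 1 + N * u * (1 - 1 / 2) := by nlinarith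
        positivity
      · nlinarith
    have h5 := hb.trans (pow_le_pow_left₀ (by
      have : 0 < 1 + N * u * (1 - 1 / 2) := by nlinarith
      positivity) hX n)
    rw [mul_pow] at h5
    have h6 := mul_le_mul_of_nonneg_right h5 (show (0:ℝ) ≤ 2 ^ n by positivity)
    calc Pl N n l u * 2 ^ (0 + b) = Pl N n l u * (1 / 2) ^ l * 2 ^ n := by
          rw [zero_add, show (2:ℝ) ^ n = 2 ^ (l + b) by rw [hn'], pow_add, one_div, inv_pow]
          field_simp
      _ ≤ _ := h6
      _ = _ := by rw [one_div, inv_pow]; field_simp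
  · have hb := Pl_bound hN n l hcn0.le hcn (z := 2) (by norm_num) (by nlinarith)
    have hl' : l = n + a := by omega
    have hX : (u * (N + 1) + (1 - u) * (2 / (1 + N * u * (1 - 2)))) / (1 + N * u) ≤
        2 * (1 + (3 * N + 2) * u) := by
      have h3 : 2 / (1 + N * u * (1 - 2)) ≤ 2 * (1 + 2 * (N * u)) := by
        rw [div_le_iff₀ (by nlinarith)]; nlinarith
      have h4 := mul_le_mul_of_nonneg_left h3 hu
      refine (div_le_self ?_ hS).trans ?_
      · have : 0 < 1 + N * u * (1 - 2) := by nlinarith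
        positivity
      · nlinarith
    have h5 := hb.trans (pow_le_pow_left₀ (by
      have : 0 < 1 + N * u * (1 - 2) := by nlinarith
      positivity) hX n)
    rw [mul_pow, hl', pow_add] at h5
    rw [hl']
    have h2 : (0:ℝ) < 2 ^ n := by positivity
    refine le_of_mul_le_mul_left (le_trans (le_of_eq ?_) h5) h2
    rw [add_zero]; ring

/-- the shifted family on `ℤ` -/
noncomputable def shiftP (N c : ℝ) (n : ℕ) (k : ℤ) : ℝ :=
  if 0 ≤ (n : ℤ) + k then Pl N n ((n : ℤ) + k).toNat (c / n) else 0

lemma shift_entropy (N c : ℝ) (n : ℕ) :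
    shannonEntropy (shiftP N c n) = shannonEntropy (fun l : ℕ => Pl N n l (c / n)) := by
  unfold shannonEntropy
  congr 1
  have hinj : Function.Injective (fun l : ℕ => (l : ℤ) - n) := by
    intro x y h
    simp at h
    exact h
  rw [← hinj.tsum_eq]
  · apply tsum_congr
    intro l
    have : shiftP N c n ((l:ℤ) - n) = Pl N n l (c / n) := by
      unfold shiftP
      rw [if_pos (by omega)]
      congr
      omega
    rw [this]
  · intro k hk
    by_contra h
    apply hk
    have : ¬ (0 ≤ (n:ℤ) + k) := by
      intro h2
      exact h ⟨((n:ℤ) + k).toNat, by simp only; omega⟩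
    simp [shiftP, this]

lemma exists_ab (k : ℤ) : ∃ a b : ℕ, k = (a:ℤ) - b ∧ (a = 0 ∨ b = 0) ∧ a + b = k.natAbs := by
  rcases le_total 0 k with h | h
  · exact ⟨k.natAbs, 0, by omega, by omega, by omega⟩
  · exact ⟨0, k.natAbs, by omega, by omega, by omega⟩

lemma q_entropy (N c : ℝ) (hN : 0 < N) (hc : 0 < c) :
    Tendsto (fun n : ℕ => shannonEntropy (fun l : ℕ => Pl N n l (c / n))) atTop
      (𝓝 (shannonEntropy (qdist N c))) := by
  simp_rw [← shift_entropy]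
  obtain ⟨s1, s2⟩ := summable_aux (r := 1 / 2) (K := Real.exp ((3 * N + 2) * c)) (by norm_num)
    (by norm_num) (by positivity)
  refine entropy_tendsto
    (B := fun k : ℤ => Real.exp ((3 * N + 2) * c) * (1 / 2) ^ k.natAbs) ?_ ?_ ?_ ?_
  · apply Summable.of_nat_of_neg <;> simpa using s1
  · apply Summable.of_nat_of_neg <;> simpa using s2
  · intro k
    obtain ⟨a, b, hk, hab, -⟩ := exists_ab k
    rw [← q_val N c a b k hk hab]
    refine (q_lim_nat N c hN hc a b hab).congr' ?_
    filter_upwards [eventually_ge_atTop b] with n hn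
    unfold shiftP
    rw [if_pos (by omega)]
    congr 1
    omega
  · have hN0 : Tendsto (fun n : ℕ => N * (c / (n:ℝ))) atTop (𝓝 (N * 0)) :=
      (tendsto_div_nat c).const_mul N
    rw [mul_zero] at hN0
    filter_upwards [eventually_gt_atTop 0, (tendsto_div_nat c).eventually (gt_mem_nhds one_pos),
      hN0.eventually (gt_mem_nhds (by norm_num : (0:ℝ) < 1 / 2))] with n hn0 hcn hcN k
    obtain ⟨a, b, hk, hab, hs⟩ := exists_ab k
    unfold shiftP
    split_ifs with h
    · refine ⟨Pl_nonneg hN _ _ (by positivity) hcn.le, ?_⟩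
      rw [← hs]
      exact q_dom N c hN hc n a b _ hab (by omega) hn0 hcn.le hcN.le
    · exact ⟨le_rfl, by positivity⟩

/-- Theorem 8 of the paper (classical form): the liminf of the coherent informations
`I_coh(Φ_{c/n,|n⟩⟨n|}, τ_N) = H(P(N,n,c/n)) − H(P(N,n,1−c/n))` is bounded below by
`H(q(N,c)) − H(p(N,c))`. -/
theorem liminf_coherent_info_ge (N c : ℝ) (hN : 0 < N) (hc : 0 < c) :
    shannonEntropy (qdist N c) - shannonEntropy (pdist N c) ≤
      Filter.liminf
        (fun n : ℕ =>
          shannonEntropy (fun l : ℕ => Pl N n l (c / n)) -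
            shannonEntropy (fun l : ℕ => Pl N n l (1 - c / n)))
        Filter.atTop := by
  exact ((q_entropy N c hN hc).sub (p_entropy N c hN hc)).liminf_eq.ge
end

section
/- For every λ ∈ (0,1), every real N > 0 and all integers n, l ≥ 0, the following series identity holds: Σ_{k=max(l−n,0)}^∞ (N/(N+1))^k · ( c_{n+k−l}^{(k,n)}(λ) )² = (N+1) · (1+Nλ)^{-(l+n+1)} · Σ_{m=max(0,n−l)}^{n} λ^{2m+l−n} (1−λ)^{n−m} N^{l+m−n} (N+1)^m binom(n,m) binom(l,n−m). (This is the summation of the series of beam-splitter matrix elements achieved by the paper's 'master equation trick': both sides equal (N+1)·⟨l| Φ_{λ,|n⟩⟨n|}(τ_N) |l⟩.) -/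
/-- The matrix elements `c_m^{(i,j)}(λ)` of the beam splitter unitary of transmissivity
`λ` in the Fock basis. Half-integer powers are real (`rpow`) powers of `λ` and `1−λ`. -/
noncomputable def bsCoeff (i j m : ℕ) (lam : ℝ) : ℝ :=
  (Real.sqrt ((i.factorial : ℝ) * (j.factorial : ℝ)))⁻¹ *
    ∑ k ∈ Finset.Icc (m - j) (min i m),
      (-1 : ℝ) ^ k * (i.choose k : ℝ) * (j.choose (m - k) : ℝ) *
        lam ^ (((i + m - 2 * k : ℕ) : ℝ) / 2) *
        (1 - lam) ^ (((j + 2 * k - m : ℕ) : ℝ) / 2) *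
        Real.sqrt ((m.factorial : ℝ) * ((i + j - m).factorial : ℝ))

open Polynomial in
noncomputable def bsF (a b : ℝ) (k n : ℕ) : Polynomial ℝ :=
  (C a + C (-b) * X) ^ k * (C b + C a * X) ^ n

noncomputable def bsD (a b : ℝ) (k n m : ℕ) : ℝ := (bsF a b k n).coeff m

noncomputable def bsP (a b : ℝ) (k n l : ℕ) : ℝ :=
  if l ≤ n + k then
    ((n + k - l).factorial : ℝ) * (l.factorial : ℝ) / ((k.factorial : ℝ) * (n.factorial : ℝ)) *
      bsD a b k n (n + k - l) ^ 2
  else 0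

open Polynomial in
lemma lin_coeff (a b : ℝ) (k s : ℕ) :
    ((C a + C b * X) ^ k : Polynomial ℝ).coeff s = (k.choose s : ℝ) * b ^ s * a ^ (k - s) := by
  rw [add_comm, add_pow, finsetSum_coeff]
  have h : ∀ i ∈ Finset.range (k+1),
      ((C b * X) ^ i * C a ^ (k - i) * (k.choose i : Polynomial ℝ)).coeff s
        = if s = i then (k.choose s : ℝ) * b ^ s * a ^ (k - s) else 0 := by
    intro i _
    have : ((C b * X) ^ i * C a ^ (k - i) * (k.choose i : Polynomial ℝ))
      = C (b ^ i * a ^ (k - i) * (k.choose i : ℝ)) * X ^ i := by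
      simp only [map_mul, map_pow, map_natCast]; ring
    rw [this, coeff_C_mul_X_pow]
    split_ifs with h
    · subst h; ring
    · rfl
  rw [Finset.sum_congr rfl h, Finset.sum_ite_eq]
  split_ifs with h
  · rfl
  · rw [Nat.choose_eq_zero_of_lt (by simpa using h)]; simp

lemma D_k0 (a b : ℝ) (n m : ℕ) : bsD a b 0 n m = (n.choose m : ℝ) * a ^ m * b ^ (n - m) := by
  unfold bsD bsF; rw [pow_zero, one_mul, lin_coeff]

lemma D_n0 (a b : ℝ) (k m : ℕ) : bsD a b k 0 m = (k.choose m : ℝ) * (-b) ^ m * a ^ (k - m) := by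
  unfold bsD bsF; rw [pow_zero, mul_one, lin_coeff]

lemma D_m0 (a b : ℝ) (k n : ℕ) : bsD a b k n 0 = a ^ k * b ^ n := by
  unfold bsD bsF; rw [Polynomial.mul_coeff_zero, lin_coeff, lin_coeff]; simp

open Polynomial in
lemma D_top (a b : ℝ) (k n : ℕ) : bsD a b k n (n + k) = (-b) ^ k * a ^ n := by
  have h : ∀ (c d : ℝ) (j : ℕ), ((C c + C d * X) ^ j : Polynomial ℝ).natDegree ≤ j := by
    intro c d j
    refine natDegree_pow_le_of_le j (m := 1) ?_ |>.trans (by simp)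
    compute_degree
  unfold bsD bsF
  rw [add_comm n k, coeff_mul_add_eq_of_natDegree_le (h _ _ _) (h _ _ _), lin_coeff, lin_coeff]
  simp

lemma D_succ_k (a b : ℝ) (k n m : ℕ) :
    bsD a b (k+1) n (m+1) = a * bsD a b k n (m+1) - b * bsD a b k n m := by
  unfold bsD
  have : bsF a b (k+1) n = Polynomial.C a * bsF a b k n
      + Polynomial.C (-b) * (bsF a b k n * Polynomial.X) := by
    unfold bsF; ring
  rw [this, Polynomial.coeff_add, Polynomial.coeff_C_mul, Polynomial.coeff_C_mul,
    Polynomial.coeff_mul_X]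
  ring

lemma D_succ_n (a b : ℝ) (k n m : ℕ) :
    bsD a b k (n+1) (m+1) = b * bsD a b k n (m+1) + a * bsD a b k n m := by
  unfold bsD
  have : bsF a b k (n+1) = Polynomial.C b * bsF a b k n
      + Polynomial.C a * (bsF a b k n * Polynomial.X) := by
    unfold bsF; ring
  rw [this, Polynomial.coeff_add, Polynomial.coeff_C_mul, Polynomial.coeff_C_mul,
    Polynomial.coeff_mul_X]

lemma D_w (a b : ℝ) (hab : a ^ 2 + b ^ 2 = 1) (k n m : ℕ) :
    bsD a b k n m = a * bsD a b (k+1) n m + b * bsD a b k (n+1) m := by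
  unfold bsD
  have h1 : Polynomial.C a * Polynomial.C a + Polynomial.C b * Polynomial.C b = 1 := by
    rw [← Polynomial.C_mul, ← Polynomial.C_mul, ← Polynomial.C_add, ← sq, ← sq, hab]; simp
  have : bsF a b k n = Polynomial.C a * bsF a b (k+1) n
      + Polynomial.C b * bsF a b k (n+1) := by
    unfold bsF
    simp only [Polynomial.C_neg]
    set A := Polynomial.C a
    set B := Polynomial.C b
    set u := (A + -B * Polynomial.X) ^ k with hu
    set v := (B + A * Polynomial.X) ^ n with hv
    rw [pow_succ, pow_succ, ← hu, ← hv]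
    linear_combination (-u * v) * h1
  conv_lhs => rw [this]
  rw [Polynomial.coeff_add, Polynomial.coeff_C_mul, Polynomial.coeff_C_mul]

open Polynomial in
lemma D_deriv (a b : ℝ) (k n m : ℕ) :
    ((m:ℝ) + 1) * bsD a b (k+1) (n+1) (m+1) =
      -((k:ℝ)+1) * b * bsD a b k (n+1) m + ((n:ℝ)+1) * a * bsD a b (k+1) n m := by
  unfold bsD
  have h : derivative (bsF a b (k+1) (n+1)) = C (-((k:ℝ)+1) * b) * bsF a b k (n+1)
      + C (((n:ℝ)+1) * a) * bsF a b (k+1) n := by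
    unfold bsF
    rw [derivative_mul, derivative_pow, derivative_pow]
    simp
    ring
  have h2 := congrArg (fun p => Polynomial.coeff p m) h
  simp only [coeff_derivative, coeff_add, coeff_C_mul] at h2
  linarith

lemma P_rec (a b : ℝ) (hab : a ^ 2 + b ^ 2 = 1) (k n l : ℕ) :
    bsP a b (k+1) (n+1) (l+1) = b ^ 2 * bsP a b k (n+1) (l+1) +
      (a ^ 2 * bsP a b (k+1) n (l+1) + a ^ 2 * bsP a b k (n+1) l
       + b ^ 2 * bsP a b (k+1) n l - bsP a b k n l) := by
  rcases lt_trichotomy l (k+n+1) with h | h | h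
  · obtain ⟨μ, hμ⟩ : ∃ μ, k + n = μ + l := ⟨k + n - l, by omega⟩
    unfold bsP
    rw [if_pos (by omega), if_pos (by omega), if_pos (by omega), if_pos (by omega),
      if_pos (by omega), if_pos (by omega)]
    rw [show n + 1 + (k+1) - (l+1) = μ + 1 by omega, show n + 1 + k - (l+1) = μ by omega,
      show n + (k+1) - (l+1) = μ by omega, show n + 1 + k - l = μ + 1 by omega,
      show n + (k+1) - l = μ + 1 by omega, show n + k - l = μ by omega]
    have e1 := D_succ_k a b k (n+1) μ
    have e2 := D_succ_n a b (k+1) n μ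
    have e3 := D_w a b hab k n μ
    have e4 := D_deriv a b k n μ
    have hc : (k:ℝ) + n = μ + l := by exact_mod_cast hμ
    simp only [Nat.factorial_succ]
    push_cast
    have f1 : (k.factorial : ℝ) ≠ 0 := by positivity
    have f2 : (n.factorial : ℝ) ≠ 0 := by positivity
    have f3 : (k:ℝ) + 1 ≠ 0 := by positivity
    have f4 : (n:ℝ) + 1 ≠ 0 := by positivity
    generalize bsD a b (k+1) (n+1) (μ+1) = Y at *
    generalize bsD a b k (n+1) μ = X1 at *
    generalize bsD a b (k+1) n (μ+1) = X2 at *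
    generalize bsD a b (k+1) n μ = X3 at *
    generalize bsD a b k (n+1) (μ+1) = X4 at *
    generalize bsD a b k n μ = w at *
    field_simp
    have hl : (l:ℝ) = k + n - μ := by linarith
    have hrel : ((k:ℝ)+1) * (b*X1) + (μ+1) * (b*X2) - (n - μ) * (a*X3) = 0 := by
      linear_combination e4 - (μ+1) * e2
    have key : ((μ:ℝ)+1)*(l+1)*Y^2 + (k+1)*(n+1)*w^2 = b^2*((l+1)*(k+1)*X1^2 + (μ+1)*(n+1)*X2^2)
        + a^2*((l+1)*(n+1)*X3^2+(μ+1)*(k+1)*X4^2) := by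
      have h4 : a * X4 = b*X2 + a*X3 + b*X1 := by linarith
      have : a^2*((l+1)*(n+1)*X3^2+(μ+1)*(k+1)*X4^2)
        = ((l+1)*(n+1)*(a*X3)^2+(μ+1)*(k+1)*(a*X4)^2) := by ring
      rw [this, h4, e2, e3, hl]
      linear_combination (-(((k:ℝ)+1) * (b*X1) + (μ+1) * (b*X2) - (n - μ) * (a*X3))) * hrel
    linear_combination key
  · subst h
    unfold bsP
    rw [if_pos (by omega), if_neg (by omega), if_neg (by omega), if_pos (by omega),
      if_pos (by omega), if_neg (by omega)]
    rw [show n + 1 + (k+1) - (k+n+1+1) = 0 by omega, 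
      show n + 1 + k - (k+n+1) = 0 by omega,
      show n + (k+1) - (k+n+1) = 0 by omega]
    simp only [D_m0, Nat.factorial_succ]
    push_cast
    have f1 : (k.factorial : ℝ) ≠ 0 := by positivity
    have f2 : (n.factorial : ℝ) ≠ 0 := by positivity
    have f3 : (k:ℝ) + 1 ≠ 0 := by positivity
    have f4 : (n:ℝ) + 1 ≠ 0 := by positivity
    field_simp
    ring
  · unfold bsP
    rw [if_neg (by omega), if_neg (by omega), if_neg (by omega), if_neg (by omega),
      if_neg (by omega), if_neg (by omega)]
    ring

lemma P_k0 (a b : ℝ) (n l : ℕ) :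
    bsP a b 0 n l = (n.choose l : ℝ) * (b^2) ^ l * (a^2) ^ (n - l) := by
  unfold bsP
  split_ifs with h
  · simp only [add_zero] at *
    rw [D_k0, Nat.choose_symm h, Nat.sub_sub_self h]
    rw [Nat.cast_choose ℝ h]
    have f1 : (l.factorial : ℝ) ≠ 0 := by positivity
    have f2 : (n.factorial : ℝ) ≠ 0 := by positivity
    have f3 : ((n-l).factorial : ℝ) ≠ 0 := by positivity
    simp only [Nat.factorial_zero, Nat.cast_one]
    field_simp
    ring
  · rw [Nat.choose_eq_zero_of_lt (by omega)]; simp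

lemma P_n0 (a b : ℝ) (k l : ℕ) :
    bsP a b k 0 l = (k.choose l : ℝ) * (a^2) ^ l * (b^2) ^ (k - l) := by
  unfold bsP
  split_ifs with h
  · simp only [zero_add] at *
    rw [D_n0, Nat.choose_symm h, Nat.sub_sub_self h]
    rw [Nat.cast_choose ℝ h, ← neg_sq b]
    generalize -b = c
    have f1 : (l.factorial : ℝ) ≠ 0 := by positivity
    have f2 : (k.factorial : ℝ) ≠ 0 := by positivity
    have f3 : ((k-l).factorial : ℝ) ≠ 0 := by positivity
    simp only [Nat.factorial_zero, Nat.cast_one]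
    field_simp
    ring
  · rw [Nat.choose_eq_zero_of_lt (by omega)]; simp

lemma P_l0 (a b : ℝ) (k n : ℕ) :
    bsP a b k n 0 = ((k + n).choose n : ℝ) * (b^2) ^ k * (a^2) ^ n := by
  unfold bsP
  rw [if_pos (by omega), Nat.sub_zero, D_top, add_comm k n, Nat.cast_add_choose, ← neg_sq b]
  generalize -b = c
  have f1 : (n.factorial : ℝ) ≠ 0 := by positivity
  have f2 : (k.factorial : ℝ) ≠ 0 := by positivity
  simp only [Nat.factorial_zero, Nat.cast_one]
  field_simp
  ring

lemma P_rec0 (a b : ℝ) (n l : ℕ) :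
    bsP a b 0 (n+1) (l+1) = a ^ 2 * bsP a b 0 n (l+1) + b ^ 2 * bsP a b 0 n l := by
  simp only [P_k0]
  rw [Nat.choose_succ_succ, Nat.add_sub_add_right]
  rcases lt_or_ge l n with h | h
  · rw [show n - l = (n - (l+1)) + 1 by omega]
    push_cast
    ring
  · rw [Nat.choose_eq_zero_of_lt (show n < l + 1 by omega)]
    push_cast
    ring

lemma hasSum_rec (P g : ℕ → ℝ) (r q G : ℝ) (hr : |r * q| < 1) (h0 : P 0 = g 0)
    (hs : ∀ k, P (k+1) = r * P k + g (k+1)) (hG : HasSum (fun k => q ^ k * g k) G) :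
    HasSum (fun k => q ^ k * P k) (G / (1 - r * q)) := by
  have hgeo : Summable (fun k : ℕ => ‖(r*q)^k‖) := by
    simpa using summable_geometric_of_lt_one (abs_nonneg _) hr
  have hGn : Summable (fun k : ℕ => ‖q ^ k * g k‖) := hG.summable.norm
  have hsum := summable_norm_sum_mul_antidiagonal_of_summable_norm hgeo hGn
  have heq : ∀ k, ∑ p ∈ Finset.HasAntidiagonal.antidiagonal k, (r*q)^p.1 * (q^p.2 * g p.2) = q ^ k * P k := by
    intro k
    induction k with
    | zero => simp [h0]
    | succ k ih =>
      rw [Finset.Nat.sum_antidiagonal_succ, hs]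
      simp only [pow_succ, mul_assoc] at ih ⊢
      have : ∀ p : ℕ × ℕ, (r*q)^p.1 * (r * (q * (q^p.2 * g p.2)))
        = (r * q) * ((r*q)^p.1 * (q^p.2 * g p.2)) := by intro p; ring
      simp only [this, ← Finset.mul_sum]
      rw [ih]; simp; ring
  simp only [heq] at hsum
  have hsum := hsum.of_norm
  have h2 := tsum_mul_tsum_eq_tsum_sum_antidiagonal_of_summable_norm hgeo hGn
  simp only [heq] at h2
  rw [hG.tsum_eq, tsum_geometric_of_norm_lt_one (by simpa using hr)] at h2
  rw [div_eq_inv_mul, h2]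
  exact hsum.hasSum

/-- closed form -/
noncomputable def bsT (g : ℝ) (n l : ℕ) : ℝ :=
  ∑ p ∈ Finset.range (n + 1), (n.choose p : ℝ) * (l.choose p : ℝ) * g ^ p

lemma T_ext (g : ℝ) (n l M : ℕ) (h : n ≤ M) :
    bsT g n l = ∑ p ∈ Finset.range (M + 1), (n.choose p : ℝ) * (l.choose p : ℝ) * g ^ p := by
  unfold bsT
  apply Finset.sum_subset
  · intro x; simp; omega
  · intro x _ hx
    rw [Nat.choose_eq_zero_of_lt (by simpa using hx)]; simp

lemma T_rec (g : ℝ) (n l : ℕ) :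
    bsT g (n+1) (l+1) = bsT g (n+1) l + bsT g n (l+1) + (g - 1) * bsT g n l := by
  have hg : g * bsT g n l = ∑ p ∈ Finset.range (n + 1),
      (n.choose p : ℝ) * (l.choose p : ℝ) * g ^ (p+1) := by
    unfold bsT; rw [Finset.mul_sum]; apply Finset.sum_congr rfl; intros; ring
  rw [sub_mul, one_mul, hg, T_ext g n (l+1) (n+1) (by omega), T_ext g n l (n+1) (by omega)]
  unfold bsT
  rw [Finset.sum_range_succ' _ (n+1), Finset.sum_range_succ' _ (n+1),
    Finset.sum_range_succ' _ (n+1), Finset.sum_range_succ' _ (n+1)]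
  simp only [Nat.choose_zero_right, pow_zero, Nat.cast_one, mul_one]
  have : ∑ p ∈ Finset.range (n + 1), ((n+1).choose (p+1) : ℝ) * ((l+1).choose (p+1) : ℝ) * g ^ (p+1)
    = ∑ p ∈ Finset.range (n + 1), ((n+1).choose (p+1) : ℝ) * (l.choose (p+1) : ℝ) * g ^ (p+1)
    + ∑ p ∈ Finset.range (n + 1), (n.choose (p+1) : ℝ) * ((l+1).choose (p+1) : ℝ) * g ^ (p+1)
    + ∑ p ∈ Finset.range (n + 1), (n.choose p : ℝ) * (l.choose p : ℝ) * g ^ (p+1)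
    - ∑ p ∈ Finset.range (n + 1), (n.choose (p+1) : ℝ) * (l.choose (p+1) : ℝ) * g ^ (p+1) := by
    rw [← Finset.sum_add_distrib, ← Finset.sum_add_distrib, ← Finset.sum_sub_distrib]
    apply Finset.sum_congr rfl
    intro p _
    rw [Nat.choose_succ_succ, Nat.choose_succ_succ]
    push_cast
    ring
  rw [this]; ring

lemma T_n0 (g : ℝ) (l : ℕ) : bsT g 0 l = 1 := by simp [bsT]

lemma T_l0 (g : ℝ) (n : ℕ) : bsT g n 0 = 1 := by
  unfold bsT; rw [Finset.sum_range_succ']; simp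

lemma hs_congr {f g : ℕ → ℝ} {A B : ℝ} (h : HasSum f A) (hf : ∀ k, g k = f k) (hA : B = A) :
    HasSum g B := by
  rw [hA, funext hf]; exact h

def bsSh (f : ℕ → ℝ) : ℕ → ℝ
  | 0 => 0
  | k + 1 => f k

lemma main_sum (N lam a b : ℝ) (hN : 0 < N) (h0 : 0 < lam) (h1 : lam < 1)
    (ha : a ^ 2 = lam) (hb : b ^ 2 = 1 - lam) (n l : ℕ) :
    HasSum (fun k : ℕ => (N / (N + 1)) ^ k * bsP a b k n l)
      ((N + 1) * ((1 + N * lam) ^ (l + n + 1))⁻¹ *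
        ((lam * (N+1)) ^ n * (lam * N) ^ l * bsT ((1 - lam) / (lam^2 * N * (N+1))) n l)) := by
  have hab : a ^ 2 + b ^ 2 = 1 := by rw [ha, hb]; ring
  set q := N / (N + 1) with hq
  have hq0 : 0 < q := by positivity
  have hq1 : q < 1 := by rw [hq, div_lt_one (by positivity)]; linarith
  have hNl : 0 < 1 + N * lam := by positivity
  have hrq : |(1 - lam) * q| < 1 := by
    rw [abs_of_nonneg (by apply mul_nonneg <;> linarith)]
    nlinarith
  have hinv : 1 - (1 - lam) * q = (1 + N * lam) / (N + 1) := by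
    rw [hq]; field_simp; ring
  have hbase := fun j : ℕ => hasSum_choose_mul_geometric_of_norm_lt_one (𝕜 := ℝ) j
    (r := (1 - lam) * q) (by simpa using hrq)
  rw [hinv] at hbase
  have hB0 : ∀ l : ℕ, HasSum (fun k : ℕ => q ^ k * bsP a b k 0 l)
      ((N + 1) * ((1 + N * lam) ^ (l + 1))⁻¹ * ((lam * N) ^ l)) := by
    intro l
    rw [← hasSum_nat_add_iff' l]
    have hz : ∑ i ∈ Finset.range l, q ^ i * bsP a b i 0 l = 0 := by
      apply Finset.sum_eq_zero
      intro i hi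
      rw [P_n0, Nat.choose_eq_zero_of_lt (by simpa using hi)]; simp
    rw [hz, sub_zero]
    refine hs_congr ((hbase l).mul_left ((lam * q) ^ l)) ?_ ?_
    · intro k
      rw [P_n0, ha, hb, Nat.add_sub_cancel]; simp only [mul_pow, pow_add]; ring
    · rw [hq]; simp only [mul_pow, div_pow, pow_succ]; field_simp
  have hBl : ∀ n : ℕ, HasSum (fun k : ℕ => q ^ k * bsP a b k n 0)
      ((N + 1) * ((1 + N * lam) ^ (n + 1))⁻¹ * ((lam * (N+1)) ^ n)) := by
    intro n
    refine hs_congr ((hbase n).mul_left (lam ^ n)) ?_ ?_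
    · intro k
      rw [P_l0, ha, hb]; simp only [mul_pow]; ring
    · simp only [mul_pow, div_pow, pow_succ]; field_simp
  induction n generalizing l with
  | zero => simpa [T_n0] using hB0 l
  | succ n ihn =>
    induction l with
    | zero => simpa [T_l0] using hBl (n+1)
    | succ l ihl =>
      set g := (1 - lam) / (lam^2 * N * (N+1)) with hg
      have A1 := (ihn (l+1)).mul_left lam
      have A2 := (ihl.mul_left (lam * q))
      have A3 := (ihn l).mul_left (1 - lam)
      have A4 := (ihn l).mul_left q
      have shift : ∀ (f : ℕ → ℝ) (c S : ℝ), HasSum (fun k => c * (q ^ k * f k)) S →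
          HasSum (fun k => q ^ k * bsSh (fun j => c / q * f j) k) S := by
        intro f c S hS
        rw [← hasSum_nat_add_iff' 1]
        simp only [Finset.sum_range_one]
        refine hs_congr hS ?_ ?_
        · intro k
          simp only [bsSh]
          rw [pow_succ]; field_simp
        · simp [bsSh]
      have B2 := shift _ _ _ A2
      have B4 := shift _ _ _ A4
      have B := ((A1.add B2).add A3).sub B4
      have hr := hasSum_rec (fun k => bsP a b k (n+1) (l+1))
        (fun k => lam * bsP a b k n (l+1) + bsSh (fun j => lam * q / q * bsP a b j (n+1) l) k
          + (1 - lam) * bsP a b k n l - bsSh (fun j => q / q * bsP a b j n l) k)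
        (1 - lam) q _ hrq (by simp only [bsSh]; rw [P_rec0, ha, hb]; ring) (by
          intro k
          simp only [bsSh]
          rw [P_rec a b hab, ha, hb]
          field_simp) (by
          refine hs_congr B ?_ rfl
          intro k; ring)
      refine hs_congr hr (fun _ => rfl) ?_
      rw [hinv, T_rec]
      generalize bsT g (n+1) l = T1
      generalize bsT g n (l+1) = T2
      generalize bsT g n l = T3
      rw [hq, hg]
      field_simp
      ring

lemma bsCoeff_eq (a b lam : ℝ) (h0 : 0 ≤ lam) (h1 : lam ≤ 1)
    (ha : a = √lam) (hb : b = √(1 - lam)) (k n m : ℕ) :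
    bsCoeff k n m lam = (Real.sqrt ((k.factorial : ℝ) * (n.factorial : ℝ)))⁻¹ *
      (Real.sqrt ((m.factorial : ℝ) * ((k + n - m).factorial : ℝ)) * bsD a b k n m) := by
  have hp : ∀ (x : ℝ) (j : ℕ), 0 ≤ x → x ^ ((j:ℝ) / 2) = (√x) ^ j := by
    intro x j hx
    rw [Real.sqrt_eq_rpow, ← Real.rpow_natCast, ← Real.rpow_mul hx]
    congr 1; ring
  unfold bsCoeff bsD bsF
  congr 1
  rw [Polynomial.coeff_mul, Finset.Nat.sum_antidiagonal_eq_sum_range_succ_mk, Finset.mul_sum]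
  simp only [lin_coeff]
  have hsub : Finset.Icc (m - n) (min k m) ⊆ Finset.range (m+1) := by
    intro x; simp only [Finset.mem_Icc, Finset.mem_range, le_min_iff]; omega
  rw [← Finset.sum_subset hsub]
  · apply Finset.sum_congr rfl
    intro s hs
    simp only [Finset.mem_Icc, le_min_iff] at hs
    rw [hp _ _ h0, hp _ _ (by linarith), ← ha, ← hb,
      show k + m - 2 * s = (k - s) + (m - s) by omega,
      show n + 2 * s - m = s + (n - (m - s)) by omega, neg_pow b]
    ring
  · intro s hs hn
    simp only [Finset.mem_Icc, le_min_iff, Finset.mem_range] at hs hn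
    by_cases hk : k < s
    · rw [Nat.choose_eq_zero_of_lt hk]; simp
    · rw [Nat.choose_eq_zero_of_lt (show n < m - s by omega)]; simp

theorem master_equation_trick (N lam : ℝ) (hN : 0 < N) (hlam : lam ∈ Set.Ioo (0 : ℝ) 1)
    (n l : ℕ) :
    HasSum
      (fun k : ℕ =>
        if l - n ≤ k then (N / (N + 1)) ^ k * bsCoeff k n (n + k - l) lam ^ 2 else 0)
      ((N + 1) * ((1 + N * lam) ^ (l + n + 1))⁻¹ *
        ∑ m ∈ Finset.Icc (n - l) n,
          lam ^ (2 * m + l - n) * (1 - lam) ^ (n - m) * N ^ (l + m - n) * (N + 1) ^ m *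
            (n.choose m : ℝ) * (l.choose (n - m) : ℝ)) := by
  obtain ⟨h0, h1⟩ := hlam
  have ha : (√lam) ^ 2 = lam := Real.sq_sqrt h0.le
  have hb : (√(1 - lam)) ^ 2 = 1 - lam := Real.sq_sqrt (by linarith)
  convert main_sum N lam _ _ hN h0 h1 ha hb n l using 1
  · ext k
    unfold bsP
    by_cases h : l - n ≤ k
    · rw [if_pos h, if_pos (by omega), bsCoeff_eq _ _ lam h0.le h1.le rfl rfl,
        show k + n - (n + k - l) = l by omega]
      rw [mul_pow, mul_pow, inv_pow, Real.sq_sqrt (by positivity), Real.sq_sqrt (by positivity)]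
      ring
    · rw [if_neg h, if_neg (by omega), mul_zero]
  · congr 1
    unfold bsT
    rw [← Finset.sum_range_reflect, Finset.mul_sum]
    have hsub : Finset.Icc (n - l) n ⊆ Finset.range (n+1) := by
      intro x; simp only [Finset.mem_Icc, Finset.mem_range]; omega
    rw [← Finset.sum_subset hsub]
    · apply Finset.sum_congr rfl
      intro m hm
      simp only [Finset.mem_Icc] at hm
      obtain ⟨p, rfl⟩ : ∃ p, n = m + p := ⟨n - m, by omega⟩
      obtain ⟨j, rfl⟩ : ∃ j, l = j + p := ⟨l - p, by omega⟩
      rw [show m + p + 1 - 1 - m = p by omega, show m + p - m = p by omega,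
        show 2 * m + (j + p) - (m + p) = m + j by omega,
        show j + p + m - (m + p) = j by omega, Nat.choose_symm_add]
      have : N + 1 ≠ 0 := by positivity
      simp only [div_pow, mul_pow]
      field_simp
      ring
    · intro m hm hn
      simp only [Finset.mem_Icc, Finset.mem_range] at hm hn
      rw [show n + 1 - 1 - m = n - m by omega,
        Nat.choose_eq_zero_of_lt (show l < n - m by omega)]
      simp
end

section
/- For every λ ∈ (0,1), every real ν > 0 and all integers n, i, l ≥ 0 with l + n ≥ i, the following series identity holds: Σ_{k=max(l−i,0)}^∞ (ν^k/(ν+1)^{k+1}) · c_{k+i−l}^{(n,k)}(λ) · c_{k+i−l}^{(i,k)}(λ) = Σ_{m=max(i−l,0)}^{min(n,i)} [ √(n!·i!·l!·(l+n−i)!) / ((n−m)!·(i−m)!·m!·(l+m−i)!) ] · ν^{l+m−i} (ν+1)^m (1−λ)^{2m+l−i} λ^{(n+i−2m)/2} / ((1−λ)ν+1)^{l+n+1}. (Both sides equal the coefficient f_{n,i,l}(λ,ν) in the Fock-basis expansion of the action Φ_{λ,τ_ν}(|n⟩⟨i|) of the thermal attenuator; the right-hand side is obtained from the paper's Kraus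 representation derived via the master equation trick.) -/
namespace TA
open PowerSeries

/-- linear power series -/
noncomputable def L (u v : ℝ) : PowerSeries ℝ := C u + C v * X

/-- explicit inverse powers of `L A B` -/
noncomputable def U (A B : ℝ) (j : ℕ) : PowerSeries ℝ :=
  PowerSeries.mk fun e => ((j + e).choose e : ℝ) * (-B) ^ e / A ^ (j + e + 1)

lemma L_mul_U_zero (A B : ℝ) (hA : A ≠ 0) : L A B * U A B 0 = 1 := by
  ext e
  rcases e with _ | e
  · simp [L, U, add_mul, mul_assoc, hA]
  · simp [L, U, add_mul, mul_assoc, coeff_succ_X_mul, coeff_one]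
    field_simp
    ring

lemma L_mul_U_succ (A B : ℝ) (hA : A ≠ 0) (j : ℕ) : L A B * U A B (j + 1) = U A B j := by
  ext e
  rcases e with _ | e
  · simp [L, U, add_mul, mul_assoc]
    field_simp
    ring
  · simp only [L, U, add_mul, mul_assoc, coeff_succ_X_mul, coeff_mk, map_add, coeff_C_mul]
    have h1 : (j + 1 + (e + 1)).choose (e + 1) = (j + 1 + e).choose e + (j + (e + 1)).choose (e + 1) := by
      rw [show j + 1 + (e + 1) = (j + 1 + e) + 1 by ring, Nat.choose_succ_succ]
      congr 2; ring
    rw [h1]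
    push_cast
    rw [show j + 1 + (e + 1) + 1 = (j + e + 1) + 2 by ring, show j + 1 + e + 1 = (j + e + 1) + 1 by ring,
      show j + (e + 1) + 1 = (j + e + 1) + 1 by ring]
    field_simp
    ring

lemma U_eq (A B : ℝ) (hA : A ≠ 0) (j : ℕ) : U A B j = U A B 0 ^ (j + 1) := by
  induction j with
  | zero => simp
  | succ j ih =>
    rw [pow_succ, ← ih, ← L_mul_U_succ A B hA j]
    linear_combination (-U A B (j+1)) * L_mul_U_zero A B hA

lemma coeff_L_pow (u v : ℝ) (a e : ℕ) :
    coeff e (L u v ^ a) = (a.choose e : ℝ) * u ^ (a - e) * v ^ e := by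
  have : ∀ k, (C v * X) ^ k * C u ^ (a - k) * ((a.choose k : ℕ) : PowerSeries ℝ)
      = C (v ^ k * u ^ (a - k) * (a.choose k : ℝ)) * X ^ k := by
    intro k; simp only [map_mul, map_pow, map_natCast]; ring
  rw [L, add_comm, add_pow, map_sum]
  simp only [this, coeff_C_mul, coeff_X_pow]
  simp only [mul_ite, mul_one, mul_zero]
  rw [Finset.sum_ite_eq]
  split_ifs with h
  · ring
  · have : a < e := by simpa using h
    simp [Nat.choose_eq_zero_of_lt this]

lemma hs_congr {f g : ℕ → ℝ} {a b : ℝ} (h : HasSum f a) (hfg : ∀ k, g k = f k) (hab : b = a) :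
    HasSum g b := by
  rw [hab, funext hfg]; exact h

lemma hasSum_shift (s : ℝ) (hs : |s| < 1) (j e : ℕ) :
    HasSum (fun a : ℕ => ((a + j).choose (j + e) : ℝ) * s ^ a) (s ^ e / (1 - s) ^ (j + e + 1)) := by
  have h0 := (hasSum_choose_mul_geometric_of_norm_lt_one (j + e) (r := s) (by simpa using hs)).mul_left (s ^ e)
  have hi : Function.Injective (fun a : ℕ => a + e) := fun a b h => by simpa using h
  rw [← hi.hasSum_iff]
  · refine hs_congr h0 (fun a => ?_) ?_
    · simp only [Function.comp]
      rw [show a + e + j = a + (j + e) by ring, pow_add]; ring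
    · ring
  · intro a ha
    have : a < e := by
      by_contra hc
      exact ha ⟨a - e, by simp; omega⟩
    rw [Nat.choose_eq_zero_of_lt (by omega)]; simp

lemma hasSum_coeff (s x : ℝ) (hs : |s| < 1) (j e : ℕ) :
    HasSum (fun a : ℕ => ((a + j).choose j : ℝ) * coeff e (C (s ^ a) * L 1 (-x) ^ a))
      (coeff e (U (1 - s) (s * x) j)) := by
  have h0 := (hasSum_shift s hs j e).mul_left (((j + e).choose e : ℝ) * (-x) ^ e)
  refine hs_congr h0 (fun a => ?_) ?_
  · rw [coeff_C_mul, coeff_L_pow, one_pow]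
    by_cases hae : e ≤ a
    · have := Nat.choose_mul (n := a + j) (k := j + e) (s := j) (by omega)
      rw [show a + j - j = a by omega, show j + e - j = e by omega] at this
      have h2 : (j + e).choose j = (j + e).choose e := by
        rw [Nat.choose_symm_add]
      rw [h2] at this
      have h3 : ((a + j).choose (j + e) : ℝ) * ((j + e).choose e) = (a + j).choose j * a.choose e := by
        exact_mod_cast this
      linear_combination (-(s ^ a * (-x) ^ e)) * h3
    · rw [Nat.choose_eq_zero_of_lt (show a < e by omega), Nat.choose_eq_zero_of_lt (show a + j < j + e by omega)]
      simp
  · simp only [U, coeff_mk]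
    rw [show -(s * x) = s * (-x) by ring, mul_pow]; ring

lemma hasSum_coeff_mul (s x : ℝ) (hs : |s| < 1) (j i : ℕ) (G : PowerSeries ℝ) :
    HasSum (fun a : ℕ => ((a + j).choose j : ℝ) * coeff i (C (s ^ a) * L 1 (-x) ^ a * G))
      (coeff i (U (1 - s) (s * x) j * G)) := by
  simp only [coeff_mul _ (_ * _) G, coeff_mul _ (U _ _ _) G, Finset.mul_sum, ← mul_assoc]
  exact hasSum_sum fun b _ => (hasSum_coeff s x hs j b.1).mul_right _

/-- polynomial of bounded degree -/
def Deg (f : PowerSeries ℝ) (d : ℕ) : Prop := ∀ e, d < e → coeff e f = 0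

lemma Deg.mul {f g : PowerSeries ℝ} {a b : ℕ} (hf : Deg f a) (hg : Deg g b) : Deg (f * g) (a + b) := by
  intro e he
  rw [coeff_mul]
  refine Finset.sum_eq_zero fun c hc => ?_
  have := Finset.HasAntidiagonal.mem_antidiagonal.1 hc
  by_cases h : a < c.1
  · rw [hf _ h, zero_mul]
  · rw [hg _ (by omega), mul_zero]

lemma Deg_L_pow (u v : ℝ) (a : ℕ) : Deg (L u v ^ a) a := by
  intro e he
  rw [coeff_L_pow, Nat.choose_eq_zero_of_lt he]; simp

/-- the key finite identity -/
lemma key1 (A B c E : ℝ) (hA : A ≠ 0) (n i l r : ℕ) (hr : r + i = l + n) :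
    coeff i (U A B r * (L A B + C (A - B) * X) ^ l * (C c * L A B + C E * X) ^ n)
      = ∑ b ∈ Finset.Icc (i - l) (min n i), (l.choose (i - b) : ℝ) * (n.choose b : ℝ) *
          (A - B) ^ (i - b) * c ^ (n - b) * E ^ b / A := by
  have hWV := L_mul_U_zero A B hA
  rw [U_eq A B hA]
  set W := L A B with hW
  set V := U A B 0 with hV
  have hterm : ∀ a b, a ≤ l → b ≤ n → coeff i (V ^ (r + 1) * (C ((A - B) ^ a * c ^ (n - b) * E ^ b * (l.choose a) * (n.choose b)) * (X ^ (a + b) * W ^ (l + n - (a + b))))) = if a + b = i then (A - B) ^ a * c ^ (n - b) * E ^ b * (l.choose a) * (n.choose b) / A else 0 := by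
    intro a b ha hb
    rw [show ∀ P Q R S : PowerSeries ℝ, P * (Q * (R * S)) = Q * (R * (S * P)) by intros; ring,
      coeff_C_mul, coeff_X_pow_mul']
    split_ifs with h1 h2 h2
    · subst h2
      rw [show l + n - (a + b) = r by omega, pow_succ, ← mul_assoc, ← mul_pow, hWV, one_pow, one_mul]
      simp [hV, U]; ring
    · have : W ^ (l + n - (a + b)) * V ^ (r + 1) = W ^ (i - (a + b) - 1) := by
        rw [show l + n - (a + b) = (i - (a + b) - 1) + (r + 1) by omega, pow_add, mul_assoc, ← mul_pow, hWV]
        simp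
      rw [this, Deg_L_pow A B _ _ (by omega), mul_zero]
    · omega
    · simp
  have hexp : V ^ (r + 1) * (W + C (A - B) * X) ^ l * (C c * W + C E * X) ^ n
      = ∑ b ∈ Finset.range (n + 1), ∑ a ∈ Finset.range (l + 1), V ^ (r + 1) * (C ((A - B) ^ a * c ^ (n - b) * E ^ b * (l.choose a) * (n.choose b)) * (X ^ (a + b) * W ^ (l + n - (a + b)))) := by
    rw [add_comm W, add_comm (C c * W), add_pow, add_pow, mul_assoc, Finset.sum_mul_sum, Finset.sum_comm, Finset.mul_sum]
    refine Finset.sum_congr rfl fun b hb => ?_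
    rw [Finset.mul_sum]
    refine Finset.sum_congr rfl fun a ha => ?_
    have ha' := Finset.mem_range.1 ha
    have hb' := Finset.mem_range.1 hb
    rw [show l + n - (a + b) = (l - a) + (n - b) by omega]
    simp only [map_mul, map_pow, map_natCast, mul_pow, pow_add]
    ring
  rw [hexp, map_sum]
  have hsub : Finset.Icc (i - l) (min n i) ⊆ Finset.range (n + 1) := by
    intro b hb; simp at hb ⊢; omega
  rw [← Finset.sum_subset hsub]
  · refine Finset.sum_congr rfl fun b hb => ?_
    have hb' := Finset.mem_Icc.1 hb
    rw [map_sum, Finset.sum_eq_single (i - b)]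
    · rw [hterm _ _ (by omega) (by omega), if_pos (by omega)]; ring
    · intro a ha hne
      have := Finset.mem_range.1 ha
      rw [hterm _ _ (by omega) (by omega), if_neg (by omega)]
    · intro hn; exfalso; apply hn; simp; omega
  · intro b hb hnb
    have := Finset.mem_range.1 hb
    rw [map_sum]
    refine Finset.sum_eq_zero fun a ha => ?_
    have := Finset.mem_range.1 ha
    rw [hterm _ _ (by omega) (by omega), if_neg]
    intro h; apply hnb; simp; omega

/-- collapse of the sum over p -/
lemma key2 (A B x be : ℝ) (hA : A ≠ 0) (n i l r : ℕ) (hr : r + i = l + n) :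
    be ^ i * coeff i (∑ p ∈ Finset.Icc (i - l) n, C ((n.choose p : ℝ) * (-1) ^ p * be ^ (l + p - i)) *
        (U A B (l + p - i) * (L 1 (-x) ^ p * L 1 1 ^ l)))
      = be ^ l * coeff i (U A B r * L 1 1 ^ l * (L A B - C be * L 1 (-x)) ^ n) := by
  have hWV := L_mul_U_zero A B hA
  rw [U_eq A B hA r]
  rw [Finset.sum_congr rfl fun p _ => by rw [U_eq A B hA (l + p - i)]]
  set W := L A B with hW
  set V := U A B 0 with hV
  have hexp : (W - C be * L 1 (-x)) ^ n = ∑ p ∈ Finset.range (n + 1),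
      C ((n.choose p : ℝ) * (-1) ^ p * be ^ p) * (L 1 (-x) ^ p * W ^ (n - p)) := by
    rw [sub_eq_add_neg, add_comm, add_pow]
    refine Finset.sum_congr rfl fun p _ => ?_
    simp only [map_mul, map_pow, map_natCast, map_neg, map_one, neg_pow (C be * L 1 (-x)), mul_pow]
    ring
  rw [hexp, Finset.mul_sum, map_sum, map_sum, Finset.mul_sum, Finset.mul_sum]
  have hsub : Finset.Icc (i - l) n ⊆ Finset.range (n + 1) := by
    intro b hb; simp at hb ⊢; omega
  rw [← Finset.sum_subset hsub]
  · refine Finset.sum_congr rfl fun p hp => ?_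
    have hp' := Finset.mem_Icc.1 hp
    have h1 : V ^ (r + 1) * W ^ (n - p) = V ^ (l + p - i + 1) := by
      rw [show r + 1 = (l + p - i + 1) + (n - p) by omega, pow_add, mul_assoc, ← mul_pow, mul_comm V W, hWV]
      simp
    rw [show V ^ (r + 1) * L 1 1 ^ l * (C ((n.choose p : ℝ) * (-1) ^ p * be ^ p) * (L 1 (-x) ^ p * W ^ (n - p)))
      = C ((n.choose p : ℝ) * (-1) ^ p * be ^ p) * ((V ^ (r + 1) * W ^ (n - p)) * (L 1 (-x) ^ p * L 1 1 ^ l)) by ring, h1,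
      coeff_C_mul, coeff_C_mul]
    have h2 : be ^ i * be ^ (l + p - i) = be ^ l * be ^ p := by
      rw [← pow_add, ← pow_add]; congr 1; omega
    linear_combination ((n.choose p : ℝ) * (-1) ^ p * coeff i (V ^ (l + p - i + 1) * (L 1 (-x) ^ p * L 1 1 ^ l))) * h2
  · intro p hp hnp
    have hp1 := Finset.mem_range.1 hp
    have hp2 : p < i - l := by
      by_contra hc; apply hnp; simp; omega
    have h1 : V ^ (r + 1) * W ^ (n - p) = W ^ (i - l - p - 1) := by
      rw [show n - p = (r + 1) + (i - l - p - 1) by omega, pow_add W, ← mul_assoc, ← mul_pow, mul_comm V W, hWV]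
      simp
    rw [show V ^ (r + 1) * L 1 1 ^ l * (C ((n.choose p : ℝ) * (-1) ^ p * be ^ p) * (L 1 (-x) ^ p * W ^ (n - p)))
      = C ((n.choose p : ℝ) * (-1) ^ p * be ^ p) * ((V ^ (r + 1) * W ^ (n - p)) * (L 1 (-x) ^ p * L 1 1 ^ l)) by ring, h1,
      coeff_C_mul]
    rw [((Deg_L_pow A B _).mul ((Deg_L_pow 1 (-x) p).mul (Deg_L_pow 1 1 l))) i (by omega)]
    simp


lemma bs_form (lam : ℝ) (h0 : 0 < lam) (h1 : lam < 1) (n i l k m r : ℕ) (hm : m + l = k + i)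
    (hr : r + i = l + n) :
    bsCoeff n k m lam = (√((n.factorial : ℝ) * k.factorial))⁻¹ * √((m.factorial : ℝ) * r.factorial) *
      √lam ^ (n + m) * ∑ p ∈ Finset.Icc (i - l) n, (-1 : ℝ) ^ p * (n.choose p : ℝ) * (k.choose (l + p - i) : ℝ) *
        (lam ^ p)⁻¹ * √(1 - lam) ^ (l + 2 * p - i) := by
  unfold bsCoeff
  rw [mul_assoc, mul_assoc, show n + k - m = r by omega]
  congr 1
  rw [Finset.mul_sum, Finset.mul_sum]
  have hsub : Finset.Icc (m - k) (min n m) ⊆ Finset.Icc (i - l) n := by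
    intro p hp; simp at hp ⊢; omega
  rw [← Finset.sum_subset hsub]
  · refine Finset.sum_congr rfl fun p hp => ?_
    have hp' := Finset.mem_Icc.1 hp
    have e1 : k.choose (m - p) = k.choose (l + p - i) := by
      rw [← Nat.choose_symm (show m - p ≤ k by omega)]; congr 1; omega
    have ha : √lam ^ 2 = lam := Real.sq_sqrt h0.le
    have ha0 : √lam ≠ 0 := (Real.sqrt_pos.2 h0).ne'
    have e2 : √lam ^ (n + m) * (lam ^ p)⁻¹ = √lam ^ (n + m - 2 * p) := by
      conv_lhs => rw [show n + m = (n + m - 2 * p) + 2 * p by omega, pow_add, pow_mul (√lam) 2 p, ha]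
      field_simp
    rw [Real.rpow_div_two_eq_sqrt _ h0.le, Real.rpow_div_two_eq_sqrt _ (by linarith),
      Real.rpow_natCast, Real.rpow_natCast, ← e2, e1, show k + 2 * p - m = l + 2 * p - i by omega]
    ring
  · intro p hp hnp
    have hp' := Finset.mem_Icc.1 hp
    rw [Nat.choose_eq_zero_of_lt (n := k)]
    · simp
    · by_contra hc
      apply hnp; simp; omega

lemma coeff_dual (x : ℝ) (m l i : ℕ) :
    coeff i (L 1 (-x) ^ m * L 1 1 ^ l) =
      ∑ q ∈ Finset.Icc (i - l) i, (m.choose q : ℝ) * (-x) ^ q * (l.choose (i - q) : ℝ) := by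
  rw [coeff_mul, Finset.Nat.sum_antidiagonal_eq_sum_range_succ_mk]
  have hsub : Finset.Icc (i - l) i ⊆ Finset.range (i + 1) := by
    intro p hp; simp at hp ⊢; omega
  rw [← Finset.sum_subset hsub]
  · refine Finset.sum_congr rfl fun q _ => ?_
    simp [coeff_L_pow]
  · intro q hq hnq
    have := Finset.mem_range.1 hq
    simp only [coeff_L_pow]
    rw [Nat.choose_eq_zero_of_lt (n := l)]
    · simp
    · by_contra hc
      apply hnq; simp; omega

lemma choose_dual (i l k m q : ℕ) (hm : m + l = k + i) (h1 : i - l ≤ q) (h2 : q ≤ i) :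
    (m.factorial : ℝ) / k.factorial * ((i.choose q : ℝ) * (k.choose (l + q - i) : ℝ)) =
      (i.factorial : ℝ) / l.factorial * ((m.choose q : ℝ) * (l.choose (i - q) : ℝ)) := by
  by_cases hq : q ≤ m
  · rw [Nat.cast_choose ℝ h2, Nat.cast_choose ℝ (show l + q - i ≤ k by omega), Nat.cast_choose ℝ hq,
      Nat.cast_choose ℝ (show i - q ≤ l by omega), show k - (l + q - i) = m - q by omega,
      show l - (i - q) = l + q - i by omega]
    have := fun a : ℕ => (Nat.cast_ne_zero (R := ℝ)).2 (Nat.factorial_ne_zero a)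
    have a1 := this k
    have a2 := this l
    have a3 := this q
    have a4 := this (i - q)
    have a5 := this (l + q - i)
    have a6 := this (m - q)
    field_simp
  · rw [Nat.choose_eq_zero_of_lt (show m < q by omega), Nat.choose_eq_zero_of_lt (show k < l + q - i by omega)]
    simp

lemma Q_dual (lam : ℝ) (h0 : 0 < lam) (h1 : lam < 1) (i l k m : ℕ) (hm : m + l = k + i) :
    √(1 - lam) ^ i * ((m.factorial : ℝ) / k.factorial * ∑ q ∈ Finset.Icc (i - l) i, (-1 : ℝ) ^ q * (i.choose q : ℝ) * (k.choose (l + q - i) : ℝ) *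
        (lam ^ q)⁻¹ * √(1 - lam) ^ (l + 2 * q - i)) =
      √(1 - lam) ^ l * ((i.factorial : ℝ) / l.factorial * coeff i (L 1 (-((1 - lam) / lam)) ^ m * L 1 1 ^ l)) := by
  rw [coeff_dual, Finset.mul_sum, Finset.mul_sum, Finset.mul_sum, Finset.mul_sum]
  refine Finset.sum_congr rfl fun q hq => ?_
  have hq' := Finset.mem_Icc.1 hq
  have hd := choose_dual i l k m q hm hq'.1 hq'.2
  have hb : √(1 - lam) ^ 2 = 1 - lam := Real.sq_sqrt (by linarith)
  have e : √(1 - lam) ^ i * √(1 - lam) ^ (l + 2 * q - i) = √(1 - lam) ^ l * (1 - lam) ^ q := by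
    rw [← pow_add, show i + (l + 2 * q - i) = l + 2 * q by omega, pow_add, pow_mul _ 2 q, hb]
  rw [neg_pow ((1 - lam) / lam), div_pow, div_eq_mul_inv ((1 - lam) ^ q)]
  linear_combination ((-1 : ℝ) ^ q * (lam ^ q)⁻¹ * ((m.factorial : ℝ) / k.factorial * ((i.choose q : ℝ) * (k.choose (l + q - i) : ℝ)))) * e + (√(1 - lam) ^ l * (1 - lam) ^ q * (-1 : ℝ) ^ q * (lam ^ q)⁻¹) * hd

lemma sqrt_comb (n i k m r l : ℕ) :
    (√((n.factorial : ℝ) * k.factorial))⁻¹ * √((m.factorial : ℝ) * r.factorial) *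
    ((√((i.factorial : ℝ) * k.factorial))⁻¹ * √((m.factorial : ℝ) * l.factorial)) =
    √((r.factorial : ℝ) * l.factorial) / √((n.factorial : ℝ) * i.factorial) * ((m.factorial : ℝ) / k.factorial) := by
  have hp := fun a : ℕ => (Nat.cast_pos (α := ℝ)).2 (Nat.factorial_pos a)
  rw [Real.sqrt_mul (hp n).le, Real.sqrt_mul (hp m).le, Real.sqrt_mul (hp i).le, Real.sqrt_mul (hp m).le,
    Real.sqrt_mul (hp r).le, Real.sqrt_mul (hp n).le]
  have hk := Real.sq_sqrt (hp k).le
  have hm := Real.sq_sqrt (hp m).le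
  have h1 := (Real.sqrt_pos.2 (hp k)).ne'
  have h2 := (Real.sqrt_pos.2 (hp n)).ne'
  have h3 := (Real.sqrt_pos.2 (hp i)).ne'
  conv_rhs => rw [← hk, ← hm]
  field_simp

lemma term_eq (lam nu : ℝ) (h0 : 0 < lam) (h1 : lam < 1) (hnu : 0 < nu) (n i l r k : ℕ)
    (hr : r + i = l + n) (hk : l - i ≤ k) :
    nu ^ k / (nu + 1) ^ (k + 1) * bsCoeff n k (k + i - l) lam * bsCoeff i k (k + i - l) lam =
    (√((r.factorial : ℝ) * l.factorial) / √((n.factorial : ℝ) * i.factorial) * ((i.factorial : ℝ) / l.factorial) *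
      √lam ^ (n + i) / (nu + 1)) *
    ∑ p ∈ Finset.Icc (i - l) n, (n.choose p : ℝ) * (-1) ^ p * (nu / (nu + 1) * (1 - lam)) ^ (l + p - i) *
      (if l + p - i ≤ k then (k.choose (l + p - i) : ℝ) * coeff i (C ((nu / (nu + 1) * lam) ^ (k - (l + p - i))) *
        L 1 (-((1 - lam) / lam)) ^ (k - (l + p - i)) * (L 1 (-((1 - lam) / lam)) ^ p * L 1 1 ^ l)) else 0) := by
  obtain ⟨m, hm⟩ : ∃ m, m + l = k + i := ⟨k + i - l, by omega⟩
  rw [show k + i - l = m by omega, bs_form lam h0 h1 n i l k m r hm hr,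
    bs_form lam h0 h1 i i l k m l hm rfl]
  have hQ := Q_dual lam h0 h1 i l k m hm
  set Q := ∑ q ∈ Finset.Icc (i - l) i, (-1 : ℝ) ^ q * (i.choose q : ℝ) * (k.choose (l + q - i) : ℝ) *
        (lam ^ q)⁻¹ * √(1 - lam) ^ (l + 2 * q - i) with hQdef
  have hs := sqrt_comb n i k m r l
  have hb0 : √(1 - lam) ≠ 0 := (Real.sqrt_pos.2 (by linarith)).ne'
  have hb : √(1 - lam) ^ 2 = 1 - lam := Real.sq_sqrt (by linarith)
  have ha : √lam ^ 2 = lam := Real.sq_sqrt h0.le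
  have hN : nu + 1 ≠ 0 := by positivity
  apply mul_left_cancel₀ (pow_ne_zero i hb0)
  set S := ∑ p ∈ Finset.Icc (i - l) n, (-1 : ℝ) ^ p * (n.choose p : ℝ) * (k.choose (l + p - i) : ℝ) *
        (lam ^ p)⁻¹ * √(1 - lam) ^ (l + 2 * p - i) with hS
  set c := coeff i (L 1 (-((1 - lam) / lam)) ^ m * L 1 1 ^ l) with hc
  have hp : √lam ^ (n + m) * √lam ^ (i + m) = √lam ^ (n + i) * lam ^ m := by
    rw [← ha, ← pow_mul, ha, ← pow_add, ← pow_add]; congr 1; ring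
  have step : √(1 - lam) ^ l * lam ^ m * (nu / (nu + 1)) ^ k * S * c = √(1 - lam) ^ i *
      ∑ p ∈ Finset.Icc (i - l) n, (n.choose p : ℝ) * (-1) ^ p * (nu / (nu + 1) * (1 - lam)) ^ (l + p - i) *
      (if l + p - i ≤ k then (k.choose (l + p - i) : ℝ) * coeff i (C ((nu / (nu + 1) * lam) ^ (k - (l + p - i))) *
        L 1 (-((1 - lam) / lam)) ^ (k - (l + p - i)) * (L 1 (-((1 - lam) / lam)) ^ p * L 1 1 ^ l)) else 0) := by
    rw [hS, Finset.mul_sum, Finset.sum_mul, Finset.mul_sum]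
    refine Finset.sum_congr rfl fun p hp => ?_
    have hp' := Finset.mem_Icc.1 hp
    split_ifs with hjk
    · have e1 : C ((nu / (nu + 1) * lam) ^ (k - (l + p - i))) *
        L 1 (-((1 - lam) / lam)) ^ (k - (l + p - i)) * (L 1 (-((1 - lam) / lam)) ^ p * L 1 1 ^ l)
        = C ((nu / (nu + 1) * lam) ^ (k - (l + p - i))) * (L 1 (-((1 - lam) / lam)) ^ m * L 1 1 ^ l) := by
        rw [show m = (k - (l + p - i)) + p by omega, pow_add]; ring
      rw [e1, coeff_C_mul, ← hc]
      have e2 : √(1 - lam) ^ l * √(1 - lam) ^ (l + 2 * p - i) = √(1 - lam) ^ i * (1 - lam) ^ (l + p - i) := by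
        rw [← hb, ← pow_mul, hb, ← pow_add, ← pow_add]; congr 1; omega
      have e3 : lam ^ m * (lam ^ p)⁻¹ = lam ^ (k - (l + p - i)) := by
        rw [show m = (k - (l + p - i)) + p by omega, pow_add]; field_simp
      have e4 : (nu / (nu + 1)) ^ k = (nu / (nu + 1)) ^ (l + p - i) * (nu / (nu + 1)) ^ (k - (l + p - i)) := by
        rw [← pow_add]; congr 1; omega
      rw [e4, mul_pow, mul_pow, ← e3]
      linear_combination (lam ^ m * (lam ^ p)⁻¹ * (nu / (nu + 1)) ^ (l + p - i) * (nu / (nu + 1)) ^ (k - (l + p - i)) * (-1 : ℝ) ^ p * (n.choose p : ℝ) * (k.choose (l + p - i) : ℝ) * c) * e2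
    · rw [Nat.choose_eq_zero_of_lt (show k < l + p - i by omega)]; simp
  have et : nu ^ k / (nu + 1) ^ (k + 1) = (nu / (nu + 1)) ^ k / (nu + 1) := by
    rw [div_pow, pow_succ]; field_simp
  rw [et]
  set R := √((r.factorial : ℝ) * l.factorial) / √((n.factorial : ℝ) * i.factorial)
  set t := (nu / (nu + 1)) ^ k
  calc _ = √(1 - lam) ^ i * (t / (nu + 1)) * ((√((n.factorial : ℝ) * k.factorial))⁻¹ * √((m.factorial : ℝ) * r.factorial) *
    ((√((i.factorial : ℝ) * k.factorial))⁻¹ * √((m.factorial : ℝ) * l.factorial))) * (√lam ^ (n + m) * √lam ^ (i + m)) * S * Q := by ring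
    _ = (t / (nu + 1)) * R * (√lam ^ (n + i) * lam ^ m) * S * (√(1 - lam) ^ i * ((m.factorial : ℝ) / k.factorial * Q)) := by
      rw [hs, hp]; ring
    _ = (R * ((i.factorial : ℝ) / l.factorial) * √lam ^ (n + i) / (nu + 1)) * (√(1 - lam) ^ l * lam ^ m * t * S * c) := by
      rw [hQ]; ring
    _ = _ := by rw [step]; ring

lemma final_id (lam nu : ℝ) (h0 : 0 < lam) (h1 : lam < 1) (hnu : 0 < nu) (n i l r : ℕ)
    (hr : r + i = l + n) :
    (√((r.factorial : ℝ) * l.factorial) / √((n.factorial : ℝ) * i.factorial) * ((i.factorial : ℝ) / l.factorial) *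
      √lam ^ (n + i) / (nu + 1)) *
    coeff i (∑ p ∈ Finset.Icc (i - l) n, C ((n.choose p : ℝ) * (-1) ^ p * (nu / (nu + 1) * (1 - lam)) ^ (l + p - i)) *
        (U (1 - nu / (nu + 1) * lam) (nu / (nu + 1) * lam * ((1 - lam) / lam)) (l + p - i) *
          (L 1 (-((1 - lam) / lam)) ^ p * L 1 1 ^ l))) =
    ∑ m ∈ Finset.Icc (i - l) (min n i),
        Real.sqrt ((n.factorial : ℝ) * (i.factorial : ℝ) * (l.factorial : ℝ) *
            (r.factorial : ℝ)) /
          (((n - m).factorial : ℝ) * ((i - m).factorial : ℝ) * (m.factorial : ℝ) *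
            ((l + m - i).factorial : ℝ)) *
          (nu ^ (l + m - i) * (nu + 1) ^ m * (1 - lam) ^ (2 * m + l - i) *
            lam ^ (((n + i - 2 * m : ℕ) : ℝ) / 2)) /
          ((1 - lam) * nu + 1) ^ (l + n + 1) := by
  have hN : 0 < nu + 1 := by positivity
  have hg : 0 < 1 - lam := by linarith
  have hD : 0 < (1 - lam) * nu + 1 := by positivity
  have hA' : 1 - nu / (nu + 1) * lam = ((1 - lam) * nu + 1) / (nu + 1) := by field_simp; ring
  have hApos : 0 < 1 - nu / (nu + 1) * lam := by rw [hA']; positivity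
  have hbe : 0 < nu / (nu + 1) * (1 - lam) := by positivity
  set A := 1 - nu / (nu + 1) * lam with hA
  have hB : nu / (nu + 1) * lam * ((1 - lam) / lam) = nu / (nu + 1) * (1 - lam) := by field_simp
  rw [hB]
  set be := nu / (nu + 1) * (1 - lam) with hbedef
  have k2 := key2 A be ((1 - lam) / lam) be hApos.ne' n i l r hr
  have k1 := key1 A be (1 / (nu + 1)) (nu / (nu + 1) * (1 - lam) ^ 2 / lam) hApos.ne' n i l r hr
  have e1 : L A be + C (A - be) * X = C A * L 1 1 := by
    simp only [L, map_sub, map_one]; ring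
  have e2 : C (1 / (nu + 1)) * L A be + C (nu / (nu + 1) * (1 - lam) ^ 2 / lam) * X =
      C A * (L A be - C be * L 1 (-((1 - lam) / lam))) := by
    have u1 : 1 / (nu + 1) * A = A * (A - be) := by rw [hA, hbedef]; field_simp; ring
    have u2 : 1 / (nu + 1) * be + nu / (nu + 1) * (1 - lam) ^ 2 / lam = A * (be + be * ((1 - lam) / lam)) := by
      rw [hA, hbedef]; field_simp; ring
    have v1 := congrArg (C (R := ℝ)) u1
    have v2 := congrArg (C (R := ℝ)) u2
    simp only [map_add, map_mul, map_sub] at v1 v2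
    simp only [L, map_neg, map_one]
    linear_combination v1 + X * v2
  rw [e1, e2, mul_pow, mul_pow, ← map_pow, ← map_pow,
    show ∀ P Q R S T : PowerSeries ℝ, P * (Q * R) * (S * T) = Q * (S * (P * R * T)) by intros; ring,
    coeff_C_mul, coeff_C_mul] at k1
  apply mul_left_cancel₀ (pow_pos hbe i).ne'
  apply mul_left_cancel₀ (pow_pos hApos (l + n)).ne'
  set F := coeff i (∑ p ∈ Finset.Icc (i - l) n, C ((n.choose p : ℝ) * (-1) ^ p * be ^ (l + p - i)) *
        (U A be (l + p - i) * (L 1 (-((1 - lam) / lam)) ^ p * L 1 1 ^ l)))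
  set Z := coeff i (U A be r * L 1 1 ^ l * (L A be - C be * L 1 (-((1 - lam) / lam))) ^ n)
  set K := √((r.factorial : ℝ) * l.factorial) / √((n.factorial : ℝ) * i.factorial) * ((i.factorial : ℝ) / l.factorial) *
      √lam ^ (n + i) / (nu + 1) with hK
  have : A ^ (l + n) * (be ^ i * (K * F)) = K * be ^ l * (A ^ l * (A ^ n * Z)) := by
    rw [pow_add]; linear_combination (K * A ^ l * A ^ n) * k2
  rw [this, k1, Finset.mul_sum, Finset.mul_sum, Finset.mul_sum]
  refine Finset.sum_congr rfl fun b hb => ?_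
  have hb' := Finset.mem_Icc.1 hb
  have hAbe : A - be = 1 / (nu + 1) := by rw [hA, hbedef]; field_simp; ring
  rw [hAbe, hA', hK, hbedef, Real.rpow_div_two_eq_sqrt _ h0.le, Real.rpow_natCast]
  obtain ⟨c, rfl⟩ : ∃ c, i = b + c := ⟨i - b, by omega⟩
  obtain ⟨e, rfl⟩ : ∃ e, n = b + e := ⟨n - b, by omega⟩
  obtain ⟨f, rfl⟩ : ∃ f, l = c + f := ⟨l - c, by omega⟩
  obtain rfl : r = f + e := by omega
  rw [show b + c - b = c by omega, show b + e - b = e by omega, show c + f + b - (b + c) = f by omega,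
    show 2 * b + (c + f) - (b + c) = b + f by omega, show b + e + (b + c) - 2 * b = e + c by omega,
    show b + e + (b + c) = 2 * b + (e + c) by omega, pow_add (√lam) (2 * b), pow_mul _ 2 b, Real.sq_sqrt h0.le,
    Nat.cast_choose ℝ (show c ≤ c + f by omega), Nat.cast_choose ℝ (show b ≤ b + e by omega),
    show c + f - c = f by omega, show b + e - b = e by omega]
  have hp := fun a : ℕ => (Nat.cast_pos (α := ℝ)).2 (Nat.factorial_pos a)
  have hsq : √(((b + e).factorial : ℝ) * (b + c).factorial * (c + f).factorial * (f + e).factorial) =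
      √(((f + e).factorial : ℝ) * (c + f).factorial) / √(((b + e).factorial : ℝ) * (b + c).factorial) * ((b + e).factorial * (b + c).factorial) := by
    have q0 : 0 < ((b + e).factorial : ℝ) * (b + c).factorial := mul_pos (hp _) (hp _)
    have q1 := Real.sq_sqrt q0.le
    have q2 := (Real.sqrt_pos.2 q0).ne'
    rw [mul_assoc (((b + e).factorial : ℝ) * (b + c).factorial), Real.sqrt_mul q0.le]
    rw [mul_comm ((c + f).factorial : ℝ)]
    rw [div_mul_eq_mul_div, eq_div_iff q2]
    linear_combination √(((f + e).factorial : ℝ) * (c + f).factorial) * q1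
  rw [hsq]
  set R := √(((f + e).factorial : ℝ) * (c + f).factorial) / √(((b + e).factorial : ℝ) * (b + c).factorial)
  have z1 := (hp (b + e)).ne'
  have z2 := (hp (b + c)).ne'
  have z3 := (hp (c + f)).ne'
  have z4 := (hp b).ne'
  have z5 := (hp c).ne'
  have z6 := (hp e).ne'
  have z7 := (hp f).ne'
  set D := (1 - lam) * nu + 1
  set g := 1 - lam
  set N := nu + 1
  simp only [div_pow, mul_pow, one_pow]
  field_simp
  ring

end TA

/-- The coefficient `f_{n,i,l}(λ,ν)` of the Fock-basis expansion of `Φ_{λ,τ_ν}(|n⟩⟨i|)`: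
the complicated series of beam-splitter matrix elements equals the simple closed form
obtained from the Kraus representation derived via the master equation trick. -/
theorem thermal_attenuator_coeff (lam nu : ℝ) (hlam : lam ∈ Set.Ioo (0 : ℝ) 1)
    (hnu : 0 < nu) (n i l : ℕ) (h : i ≤ l + n) :
    HasSum
      (fun k : ℕ =>
        if l - i ≤ k then
          nu ^ k / (nu + 1) ^ (k + 1) * bsCoeff n k (k + i - l) lam * bsCoeff i k (k + i - l) lam
        else 0)
      (∑ m ∈ Finset.Icc (i - l) (min n i),
        Real.sqrt ((n.factorial : ℝ) * (i.factorial : ℝ) * (l.factorial : ℝ) *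
            ((l + n - i).factorial : ℝ)) /
          (((n - m).factorial : ℝ) * ((i - m).factorial : ℝ) * (m.factorial : ℝ) *
            ((l + m - i).factorial : ℝ)) *
          (nu ^ (l + m - i) * (nu + 1) ^ m * (1 - lam) ^ (2 * m + l - i) *
            lam ^ (((n + i - 2 * m : ℕ) : ℝ) / 2)) /
          ((1 - lam) * nu + 1) ^ (l + n + 1)) := by
  obtain ⟨h0, h1⟩ := hlam
  obtain ⟨r, hr⟩ : ∃ r, r + i = l + n := ⟨l + n - i, by omega⟩
  rw [show l + n - i = r by omega, ← TA.final_id lam nu h0 h1 hnu n i l r hr]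
  have hs : |nu / (nu + 1) * lam| < 1 := by
    rw [abs_of_pos (by positivity)]
    have : nu / (nu + 1) < 1 := by rw [div_lt_one (by positivity)]; linarith
    have : 0 < nu / (nu + 1) := by positivity
    nlinarith
  have hp : ∀ p ∈ Finset.Icc (i - l) n, HasSum (fun k : ℕ => (n.choose p : ℝ) * (-1) ^ p *
      (nu / (nu + 1) * (1 - lam)) ^ (l + p - i) *
      (if l + p - i ≤ k then (k.choose (l + p - i) : ℝ) * PowerSeries.coeff i
        (PowerSeries.C ((nu / (nu + 1) * lam) ^ (k - (l + p - i))) *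
        TA.L 1 (-((1 - lam) / lam)) ^ (k - (l + p - i)) *
          (TA.L 1 (-((1 - lam) / lam)) ^ p * TA.L 1 1 ^ l)) else 0))
      (PowerSeries.coeff i (PowerSeries.C ((n.choose p : ℝ) * (-1) ^ p *
        (nu / (nu + 1) * (1 - lam)) ^ (l + p - i)) *
        (TA.U (1 - nu / (nu + 1) * lam) (nu / (nu + 1) * lam * ((1 - lam) / lam)) (l + p - i) *
          (TA.L 1 (-((1 - lam) / lam)) ^ p * TA.L 1 1 ^ l)))) := by
    intro p _
    rw [PowerSeries.coeff_C_mul]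
    refine HasSum.mul_left _ ?_
    set j := l + p - i
    have hi : Function.Injective (fun a : ℕ => a + j) := fun a b h => by simpa using h
    rw [← hi.hasSum_iff]
    · refine TA.hs_congr (TA.hasSum_coeff_mul _ _ hs j i _) (fun a => ?_) rfl
      simp only [Function.comp]
      rw [if_pos (by omega), show a + j - j = a by omega]
    · intro a ha
      rw [if_neg]
      intro hc
      exact ha ⟨a - j, by simp; omega⟩
  have hsum := (hasSum_sum hp).mul_left (√((r.factorial : ℝ) * l.factorial) /
    √((n.factorial : ℝ) * i.factorial) * ((i.factorial : ℝ) / l.factorial) *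
      √lam ^ (n + i) / (nu + 1))
  rw [← map_sum] at hsum
  refine TA.hs_congr hsum (fun k => ?_) rfl
  split_ifs with hk
  · exact TA.term_eq lam nu h0 h1 hnu n i l r k hr hk
  · rw [Finset.sum_eq_zero, mul_zero]
    intro p hp
    rw [if_neg, mul_zero]
    omega
end
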